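/- arXiv:0901.3894 — 2 statements merged into one kernel-verified Lean document; each statement's English description precedes it below -/
import Mathlib

section
/- Let G be a cyclically 5-edge-connected cubic graph and e an edge of G. If G − e (obtained by deleting the edge e and keeping its end-vertices) is not matching covered, then G contains an edge f such that G − {e,f} is matching covered and bipartite. -/
open scoped Classical

noncomputable section

/-- A finite multigraph: finitely many vertices and edges, each edge has an
unordered pair of endpoints (parallel edges and loops are allowed). -/
structure Multigraph where
  V : Type
  E : Type
  fintypeV : Fintype V := by infer_instance
  fintypeE : Fintype E := by infer_instance
  ends : E → Sym2 V

namespace Multigraph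

instance (G : Multigraph) : Fintype G.V := G.fintypeV
instance (G : Multigraph) : Fintype G.E := G.fintypeE

/-- The number of endpoints of the edge `e` that are equal to `v`
(a loop at `v` counts twice). -/
def inc (G : Multigraph) (v : G.V) (e : G.E) : ℕ :=
  if G.ends e = Sym2.diag v then 2 else if v ∈ G.ends e then 1 else 0

/-- The degree of a vertex: the number of edge-ends at it (loops count twice). -/
def degree (G : Multigraph) (v : G.V) : ℕ := ∑ e : G.E, G.inc v e

/-- A graph is cubic if every vertex has degree three. -/
def IsCubic (G : Multigraph) : Prop := ∀ v : G.V, G.degree v = 3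

/-- A perfect matching: a set of (non-loop) edges such that every vertex is
incident with exactly one edge of the set. -/
def IsPerfectMatching (G : Multigraph) (M : Finset G.E) : Prop :=
  (∀ e ∈ M, ¬ (G.ends e).IsDiag) ∧
  ∀ v : G.V, ∃! e, e ∈ M ∧ v ∈ G.ends e

/-- The number of perfect matchings of `G`. -/
def pmCount (G : Multigraph) : ℕ :=
  Nat.card {M : Finset G.E // G.IsPerfectMatching M}

/-- Every edge lies in some perfect matching. -/
def MatchingCovered (G : Multigraph) : Prop :=
  ∀ e : G.E, ∃ M, G.IsPerfectMatching M ∧ e ∈ M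

/-- Every edge lies in at least two perfect matchings. -/
def MatchingDoubleCovered (G : Multigraph) : Prop :=
  ∀ e : G.E, 2 ≤ Nat.card {M : Finset G.E // G.IsPerfectMatching M ∧ e ∈ M}

/-- Adjacency via some edge. -/
def Adj (G : Multigraph) (u v : G.V) : Prop := ∃ e : G.E, G.ends e = s(u, v)

/-- The graph is connected. -/
def Connected (G : Multigraph) : Prop :=
  Nonempty G.V ∧ ∀ u v : G.V, Relation.ReflTransGen G.Adj u v

/-- The edge-cut `E(A, Aᶜ)`: edges with one end in `A` and the other outside. -/
def cutEdges (G : Multigraph) (A : Set G.V) : Set G.E :=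
  {e | ∃ u v, G.ends e = s(u, v) ∧ u ∈ A ∧ v ∉ A}

/-- `G` is `k`-edge-connected: no edge-cut has fewer than `k` edges. -/
def EdgeConnected (G : Multigraph) (k : ℕ) : Prop :=
  ∀ A : Set G.V, A.Nonempty → A ≠ Set.univ → k ≤ (G.cutEdges A).ncard

/-- Bridgeless = 2-edge-connected: connected with no edge-cut of size `< 2`. -/
def Bridgeless (G : Multigraph) : Prop := G.Connected ∧ G.EdgeConnected 2

/-- The subgraph induced on `A` contains a cycle (two parallel edges count as a
cycle of length two): there is a nonempty set of edges inside `A` in which every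
vertex is incident with zero or at least two edge-ends. -/
def HasCycleWithin (G : Multigraph) (A : Set G.V) : Prop :=
  ∃ F : Finset G.E, F.Nonempty ∧ (∀ e ∈ F, ∀ v ∈ G.ends e, v ∈ A) ∧
    ∀ v : G.V, (∑ e ∈ F, G.inc v e) ≠ 1

/-- The edge-cut `E(A, Aᶜ)` is cyclic: both sides contain a cycle. -/
def IsCyclicCut (G : Multigraph) (A : Set G.V) : Prop :=
  G.HasCycleWithin A ∧ G.HasCycleWithin Aᶜ

/-- `G` is cyclically `k`-edge-connected: no cyclic edge-cut has fewer than `k` edges. -/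
def CyclicallyEdgeConnected (G : Multigraph) (k : ℕ) : Prop :=
  ∀ A : Set G.V, G.IsCyclicCut A → k ≤ (G.cutEdges A).ncard

/-- A cut is tight: every perfect matching contains exactly one of its edges. -/
def IsTightCut (G : Multigraph) (A : Set G.V) : Prop :=
  ∀ M : Finset G.E, G.IsPerfectMatching M →
    (M.filter (fun e => e ∈ G.cutEdges A)).card = 1

/-- Adjacency within a set `A` of vertices. -/
def AdjOn (G : Multigraph) (A : Set G.V) (u v : G.V) : Prop :=
  u ∈ A ∧ v ∈ A ∧ G.Adj u v

/-- The subgraph induced on `A` is connected (any two of its vertices are joined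
by a walk inside `A`). -/
def ConnectedOn (G : Multigraph) (A : Set G.V) : Prop :=
  ∀ u ∈ A, ∀ v ∈ A, Relation.ReflTransGen (G.AdjOn A) u v

/-- `G` is `k`-vertex-connected: it has at least `k+1` vertices and removing any
set of at most `k-1` vertices leaves it connected. -/
def VertexConnected (G : Multigraph) (k : ℕ) : Prop :=
  k + 1 ≤ Fintype.card G.V ∧
  ∀ T : Set G.V, T.ncard ≤ k - 1 → G.ConnectedOn Tᶜ

/-- `{x, y}` is a 2-vertex-cut: removing both vertices disconnects the graph. -/
def IsVertexCutPair (G : Multigraph) (x y : G.V) : Prop :=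
  x ≠ y ∧ ¬ G.ConnectedOn ({x, y}ᶜ)

/-- `G` is bipartite: the vertices split into two classes so that each edge
joins the two classes. -/
def Bipartite (G : Multigraph) : Prop :=
  ∃ X : Set G.V, ∀ e : G.E, ∃ u v, G.ends e = s(u, v) ∧ u ∈ X ∧ v ∉ X

/-- Delete a set of edges (keeping all vertices). -/
def deleteEdges (G : Multigraph) (F : Set G.E) : Multigraph where
  V := G.V
  E := {e : G.E // e ∉ F}
  ends e := G.ends e.1

/-- Contract the vertex set `A` to a single vertex (`none`), deleting the arising
loops and keeping parallel edges. -/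
def contract (G : Multigraph) (A : Set G.V) : Multigraph where
  V := Option {x : G.V // x ∉ A}
  E := {e : G.E // ¬ ∀ v ∈ G.ends e, v ∈ A}
  ends e := (G.ends e.1).map fun x => if h : x ∈ A then none else some ⟨x, h⟩

/-- Isomorphism of multigraphs. -/
def Iso (G₁ G₂ : Multigraph) : Prop :=
  ∃ (f : G₁.V ≃ G₂.V) (g : G₁.E ≃ G₂.E), ∀ e, G₂.ends (g e) = (G₁.ends e).map f

/-- The complete graph on four vertices. -/
def K4 : Multigraph where
  V := Fin 4
  E := {p : Fin 4 × Fin 4 // p.1 < p.2}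
  ends p := s(p.1.1, p.1.2)

/-- The result of simultaneously replacing every vertex of `S` by a triangle;
`σ e v` records to which of the three triangle vertices at `v` the edge `e`
(formerly ending at `v`) is attached. -/
def expandTriangles (H : Multigraph) (S : Set H.V) (σ : H.E → H.V → Fin 3) :
    Multigraph where
  V := {x : H.V // x ∉ S} ⊕ (S × Fin 3)
  E := H.E ⊕ (S × Fin 3)
  ends e :=
    match e with
    | Sum.inl e => (H.ends e).map fun x =>
        if h : x ∈ S then Sum.inr (⟨x, h⟩, σ e x) else Sum.inl ⟨x, h⟩
    | Sum.inr (w, i) => s(Sum.inr (w, i + 1), Sum.inr (w, i + 2))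

/-- `G` is obtained from `H` by replacing each vertex of `S` with a triangle:
the three edges formerly incident with a vertex of `S` get attached to the three
distinct new triangle vertices. -/
def IsTriangleExpansion (H : Multigraph) (S : Set H.V) (G : Multigraph) : Prop :=
  ∃ σ : H.E → H.V → Fin 3,
    (∀ v ∈ S, ∀ e : H.E, H.ends e ≠ Sym2.diag v) ∧
    (∀ v ∈ S, Set.InjOn (fun e => σ e v) {e : H.E | v ∈ H.ends e}) ∧
    Iso (expandTriangles H S σ) G

/-- Klee-graphs: `K₄` together with everything obtainable by repeatedly replacing
a vertex with a triangle. -/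
inductive IsKlee : Multigraph → Prop
  | k4 (G : Multigraph) : Iso K4 G → IsKlee G
  | expand (G : Multigraph) (v : G.V) (H : Multigraph) :
      IsKlee G → IsTriangleExpansion G {v} H → IsKlee H

/-- A nice 3-edge-cut (of a cubic graph). -/
def IsNiceCut (G : Multigraph) (A : Set G.V) : Prop :=
  A.Nonempty ∧ A ≠ Set.univ ∧ (G.cutEdges A).ncard = 3 ∧
  ¬ IsKlee (G.contract A) ∧
  (¬ IsKlee (G.contract Aᶜ) ∨
   9 ≤ A.ncard ∨
   (5 ≤ A.ncard ∧ ¬ G.IsTightCut A) ∨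
   (A.ncard = 3 ∧
     2 ≤ Nat.card {M : Finset G.E // G.IsPerfectMatching M ∧
       ∀ e ∈ G.cutEdges A, e ∈ M}))

/-- A brace: a bipartite matching covered graph without nontrivial tight edge-cuts. -/
def IsBrace (H : Multigraph) : Prop :=
  H.Bipartite ∧ H.MatchingCovered ∧
  ∀ A : Set H.V, 2 ≤ A.ncard → 2 ≤ Aᶜ.ncard → ¬ H.IsTightCut A

/-- Data describing a simultaneous gluing of graphs `K w` (through their vertices
`z w`) onto the vertices `w ∈ W` of `H`: the edge `e` of `H` incident with `w`
is identified with the edge `ε w e` of `K w` incident with `z w`, whose other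
end is `y w e`. -/
structure GlueData (H : Multigraph) (W : Set H.V) where
  K : W → Multigraph
  z : (w : W) → (K w).V
  d : (w : W) → {x : (K w).V // x ≠ z w}
  ε : (w : W) → H.E → (K w).E
  y : (w : W) → H.E → {x : (K w).V // x ≠ z w}
  noloop : ∀ (w : W) (e : H.E), H.ends e ≠ Sym2.diag (w : H.V)
  noloopK : ∀ (w : W) (k : (K w).E), (K w).ends k ≠ Sym2.diag (z w)
  ends_eq : ∀ (w : W) (e : H.E), (w : H.V) ∈ H.ends e →
      (K w).ends (ε w e) = s(z w, (y w e : (K w).V))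
  inj : ∀ w : W, Set.InjOn (ε w) {e : H.E | (w : H.V) ∈ H.ends e}
  surj : ∀ (w : W) (k : (K w).E), z w ∈ (K w).ends k →
      ∃ e : H.E, (w : H.V) ∈ H.ends e ∧ ε w e = k

/-- The graph obtained by gluing each `D.K w` through `D.z w` onto the vertex
`w ∈ W` of `H`. -/
def glue (H : Multigraph) (W : Set H.V) (D : GlueData H W) : Multigraph where
  V := {x : H.V // x ∉ W} ⊕ (Σ w : W, {x : (D.K w).V // x ≠ D.z w})
  E := H.E ⊕ (Σ w : W, {k : (D.K w).E // D.z w ∉ (D.K w).ends k})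
  ends e :=
    match e with
    | Sum.inl e => (H.ends e).map fun x =>
        if h : x ∈ W then Sum.inr ⟨⟨x, h⟩, D.y ⟨x, h⟩ e⟩ else Sum.inl ⟨x, h⟩
    | Sum.inr ⟨w, k⟩ => ((D.K w).ends k.1).map fun x =>
        if h : x = D.z w then Sum.inr ⟨w, D.d w⟩ else Sum.inr ⟨w, ⟨x, h⟩⟩

/-- The multiset of vertex degrees different from three. -/
def nonCubicDegrees (G : Multigraph) : Multiset ℕ :=
  ((Finset.univ : Finset G.V).val.map G.degree).filter (· ≠ 3)

/-- `H` is an odd minor of `G`: it is obtained by contracting pairwise disjoint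
connected subgraphs, each with an odd number of vertices (deleting arising loops
and keeping parallel edges). -/
def IsOddMinor (G H : Multigraph) : Prop :=
  ∃ π : G.V → H.V, Function.Surjective π ∧
    (∀ w : H.V, G.ConnectedOn (π ⁻¹' {w}) ∧ Odd (π ⁻¹' {w}).ncard) ∧
    ∃ g : {e : G.E // ∃ u v, G.ends e = s(u, v) ∧ π u ≠ π v} ≃ H.E,
      ∀ e, H.ends (g e) = (G.ends e.1).map π

/-- The 6-vertex graph consisting of two nonadjacent vertices `x = 0`, `y = 1`
and four vertices `a = 2`, `b = 3`, `c = 4`, `d = 5`, with edges `ab`, `cd` and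
an edge from each of `a`, `b`, `c`, `d` to each of `x` and `y`. -/
def specialGraph : Multigraph where
  V := Fin 6
  E := Fin 10
  ends := ![s(2, 3), s(4, 5), s(2, 0), s(2, 1), s(3, 0), s(3, 1),
            s(4, 0), s(4, 1), s(5, 0), s(5, 1)]

/-- The perfect matching polytope: the convex hull of the characteristic vectors
of the perfect matchings. -/
def pmPolytope (G : Multigraph) : Set (G.E → ℝ) :=
  convexHull ℝ {w | ∃ M : Finset G.E, G.IsPerfectMatching M ∧
    w = fun e => if e ∈ M then (1 : ℝ) else 0}

end Multigraph

open Multigraph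

/-- If a finite simple graph of even order has no perfect matching, then some vertex set `S` leaves
at least `|S| + 2` pieces with no edges between different pieces. -/
theorem SimpleGraph.exists_pieces_of_no_perfectMatching {V : Type} [Fintype V]
    (H : SimpleGraph V) (heven : Even (Nat.card V))
    (hno : ∀ M : H.Subgraph, ¬ M.IsPerfectMatching) :
    ∃ (S : Finset V) (ι : Type) (_ : Fintype ι) (C : ι → Finset V),
      (∀ i, (C i).Nonempty) ∧ (∀ i j v, v ∈ C i → v ∈ C j → i = j) ∧
      (∀ i, ∀ v ∈ C i, v ∉ S) ∧
      (∀ i, ∀ v ∈ C i, ∀ w, H.Adj v w → w ∈ C i ∨ w ∈ S) ∧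
      S.card + 2 ≤ Fintype.card ι := by
  obtain ⟨u, hu⟩ := H.exists_isTutteViolator hno heven
  rw [SimpleGraph.IsTutteViolator] at hu
  set K := ((⊤ : H.Subgraph).deleteVerts u).coe with hK
  have hparity := SimpleGraph.odd_ncard_oddComponents (G := K)
  have hcard : Nat.card ((⊤ : H.Subgraph).deleteVerts u).verts + u.ncard = Nat.card V := by
    rw [Nat.card_coe_set_eq, ← Set.ncard_add_ncard_compl u]
    have : ((⊤ : H.Subgraph).deleteVerts u).verts = uᶜ := by ext; simp
    rw [this, add_comm]
  refine ⟨u.toFinset, K.oddComponents, inferInstance,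
    fun c => (Subtype.val '' c.1.supp).toFinset, ?_, ?_, ?_, ?_, ?_⟩
  · rintro ⟨c, hc⟩
    obtain ⟨v, hv⟩ := c.nonempty_supp
    exact ⟨v, by simpa using ⟨v.2.2, hv⟩⟩
  · rintro ⟨c, hc⟩ ⟨d, hd⟩ v hv hv'
    simp only [Set.mem_toFinset, Set.mem_image] at hv hv'
    obtain ⟨a, ha, rfl⟩ := hv
    obtain ⟨b, hb, hab⟩ := hv'
    obtain rfl := Subtype.ext hab
    simp only [SimpleGraph.ConnectedComponent.mem_supp_iff] at ha hb
    exact Subtype.ext (ha.symm.trans hb)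
  · rintro ⟨c, hc⟩ v hv
    simp only [Set.mem_toFinset, Set.mem_image] at hv ⊢
    obtain ⟨a, ha, rfl⟩ := hv
    exact a.2.2
  · rintro ⟨c, hc⟩ v hv w hvw
    simp only [Set.mem_toFinset, Set.mem_image] at hv ⊢
    obtain ⟨a, ha, rfl⟩ := hv
    by_cases hw : w ∈ u
    · exact Or.inr hw
    · refine Or.inl ⟨⟨w, by simpa using hw⟩, ?_, rfl⟩
      refine SimpleGraph.ConnectedComponent.mem_supp_of_adj_mem_supp c ha ?_
      have := a.2.2
      simp only [hK, SimpleGraph.Subgraph.coe_adj, SimpleGraph.Subgraph.deleteVerts_adj]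
      simp_all
  · rw [← Nat.card_eq_fintype_card, Nat.card_coe_set_eq, ← Set.ncard_eq_toFinset_card']
    rw [← Nat.not_even_iff_odd, ← Nat.not_even_iff_odd, not_iff_not] at hparity
    rw [← hcard] at heven
    grind

namespace Multigraph

/-- A fixed-point-free involution moving vertices along edges gives a perfect matching. -/
theorem exists_perfectMatching_of_involution (G : Multigraph) (p : G.V → G.V)
    (hp : ∀ v, p (p v) = v) (hne : ∀ v, p v ≠ v) (hadj : ∀ v, G.Adj v (p v))
    (f : G.E) (x : G.V) (hf : G.ends f = s(x, p x)) :
    ∃ M, G.IsPerfectMatching M ∧ f ∈ M := by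
  have hex : ∀ v, ∃ g, G.ends g = s(v, p v) ∧ (s(v, p v) = s(x, p x) → g = f) := by
    intro v
    by_cases hv : s(v, p v) = s(x, p x)
    · exact ⟨f, by rw [hf, hv], fun _ => rfl⟩
    · obtain ⟨g, hg⟩ := hadj v
      exact ⟨g, hg, fun h => absurd h hv⟩
  have hex' : ∀ q : Sym2 G.V, ∃ g,
      (∃ v, q = s(v, p v)) → G.ends g = q ∧ (q = s(x, p x) → g = f) := by
    intro q
    by_cases hq : ∃ v, q = s(v, p v)
    · obtain ⟨v, rfl⟩ := hq
      obtain ⟨g, hg⟩ := hex v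
      exact ⟨g, fun _ => hg⟩
    · exact ⟨f, fun h => absurd h hq⟩
  choose ed hed using hex'
  refine ⟨Finset.univ.image fun v => ed s(v, p v), ⟨?_, ?_⟩, ?_⟩
  · intro g hg
    obtain ⟨v, -, rfl⟩ := Finset.mem_image.1 hg
    rw [(hed _ ⟨v, rfl⟩).1, Sym2.mk_isDiag_iff]
    exact (hne v).symm
  · intro v
    refine ⟨ed s(v, p v), ⟨Finset.mem_image_of_mem _ (Finset.mem_univ v), ?_⟩, ?_⟩
    · rw [(hed _ ⟨v, rfl⟩).1]
      exact Sym2.mem_mk_left _ _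
    · rintro g ⟨hg, hvg⟩
      obtain ⟨w, -, rfl⟩ := Finset.mem_image.1 hg
      rw [(hed _ ⟨w, rfl⟩).1, Sym2.mem_iff] at hvg
      rcases hvg with rfl | rfl
      · rfl
      · simp only [hp, Sym2.eq_swap]
  · exact Finset.mem_image.2 ⟨x, Finset.mem_univ _, (hed _ ⟨x, rfl⟩).2 rfl⟩

/-- If no perfect matching contains `f`, then some vertex set `S` containing both ends of `f` leaves at
least `|S|` pieces with no edges between different pieces. -/
theorem exists_pieces_of_no_perfectMatching (G : Multigraph) (heven : Even (Nat.card G.V))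
    {f : G.E} {x y : G.V} (hf : G.ends f = s(x, y)) (hxy : x ≠ y)
    (hno : ¬ ∃ M, G.IsPerfectMatching M ∧ f ∈ M) :
    ∃ (S : Finset G.V) (ι : Type) (_ : Fintype ι) (C : ι → Finset G.V),
      x ∈ S ∧ y ∈ S ∧
      (∀ i, (C i).Nonempty) ∧ (∀ i j v, v ∈ C i → v ∈ C j → i = j) ∧
      (∀ i, ∀ v ∈ C i, v ∉ S) ∧
      (∀ i, ∀ v ∈ C i, ∀ w, G.Adj v w → w ∈ C i ∨ w ∈ S) ∧
      S.card ≤ Fintype.card ι := by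
  let W := {v : G.V // v ∉ ({x, y} : Finset G.V)}
  let H : SimpleGraph W :=
    { Adj := fun a b => a ≠ b ∧ G.Adj a b
      symm := ⟨by
        rintro a b ⟨h, g, hg⟩
        exact ⟨h.symm, g, by rw [hg, Sym2.eq_swap]⟩⟩
      loopless := ⟨fun a h => h.1 rfl⟩ }
  have hW : Even (Nat.card W) := by
    have h1 : Nat.card W = Nat.card G.V - 2 := by
      rw [Nat.card_eq_fintype_card, Nat.card_eq_fintype_card, Fintype.card_subtype_compl,
        Fintype.card_coe, Finset.card_pair hxy]
    rw [h1]
    exact heven.tsub even_two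
  have hnoH : ∀ M : H.Subgraph, ¬ M.IsPerfectMatching := by
    intro M hM
    rw [SimpleGraph.Subgraph.isPerfectMatching_iff] at hM
    choose q hq hq' using hM
    have hqq : ∀ a, q (q a) = a := fun a => (hq' _ _ (hq a).symm).symm
    have hqa : ∀ a, H.Adj a (q a) := fun a => (hq a).adj_sub
    let p : G.V → G.V := fun v =>
      if v = x then y else if v = y then x else
        if h : v ∉ ({x, y} : Finset G.V) then q ⟨v, h⟩ else v
    have hpx : p x = y := by simp [p]
    have hpy : p y = x := by simp [p, hxy.symm]
    have hpW : ∀ a : W, p a = q a := by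
      rintro ⟨a, ha⟩
      have ha' := ha
      simp only [Finset.mem_insert, Finset.mem_singleton, not_or] at ha'
      simp [p, ha'.1, ha'.2]
    have hcases : ∀ v, v = x ∨ v = y ∨ ∃ a : W, a = v := by
      intro v
      by_cases h : v ∈ ({x, y} : Finset G.V)
      · simp only [Finset.mem_insert, Finset.mem_singleton] at h
        tauto
      · exact Or.inr (Or.inr ⟨⟨v, h⟩, rfl⟩)
    refine hno (G.exists_perfectMatching_of_involution p ?_ ?_ ?_ f x (by rw [hf, hpx]))
    · intro v
      rcases hcases v with rfl | rfl | ⟨a, rfl⟩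
      · rw [hpx, hpy]
      · rw [hpy, hpx]
      · rw [hpW, hpW, hqq]
    · intro v
      rcases hcases v with rfl | rfl | ⟨a, rfl⟩
      · rw [hpx]; exact hxy.symm
      · rw [hpy]; exact hxy
      · rw [hpW]
        exact fun h => (hqa a).1 (Subtype.ext h.symm)
    · intro v
      rcases hcases v with rfl | rfl | ⟨a, rfl⟩
      · rw [hpx]; exact ⟨f, hf⟩
      · rw [hpy]; exact ⟨f, by rw [hf, Sym2.eq_swap]⟩
      · rw [hpW]; exact (hqa a).2
  obtain ⟨S, ι, _, C, hC, hdisj, hCS, hadj, hcard⟩ :=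
    H.exists_pieces_of_no_perfectMatching hW hnoH
  refine ⟨{x, y} ∪ S.map (Function.Embedding.subtype _), ι, ‹_›,
    fun i => (C i).map (Function.Embedding.subtype _), by simp, by simp, ?_, ?_, ?_, ?_, ?_⟩
  · exact fun i => (hC i).map
  · intro i j v hv hv'
    simp only [Finset.mem_map, Function.Embedding.subtype_apply] at hv hv'
    obtain ⟨a, ha, rfl⟩ := hv
    obtain ⟨b, hb, hab⟩ := hv'
    obtain rfl := Subtype.ext hab
    exact hdisj i j b ha hb
  · intro i v hv hvS
    simp only [Finset.mem_map, Finset.mem_union, Function.Embedding.subtype_apply] at hv hvS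
    obtain ⟨a, ha, rfl⟩ := hv
    rcases hvS with hvS | ⟨b, hb, hab⟩
    · exact a.2 hvS
    · obtain rfl := Subtype.ext hab
      exact hCS i b ha hb
  · intro i v hv w hvw
    simp only [Finset.mem_map, Finset.mem_union, Function.Embedding.subtype_apply] at hv ⊢
    obtain ⟨a, ha, rfl⟩ := hv
    by_cases hw : w ∈ ({x, y} : Finset G.V)
    · exact Or.inr (Or.inl hw)
    · by_cases haw : a = ⟨w, hw⟩
      · exact Or.inl ⟨a, ha, by rw [haw]⟩
      · rcases hadj i a ha ⟨w, hw⟩ ⟨haw, hvw⟩ with h | h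
        · exact Or.inl ⟨_, h, rfl⟩
        · exact Or.inr (Or.inr ⟨_, h, rfl⟩)
  · refine (Finset.card_union_le _ _).trans ?_
    rw [Finset.card_map, Finset.card_pair hxy]
    omega

theorem inc_eq (G : Multigraph) {g : G.E} {a b : G.V} (hg : G.ends g = s(a, b)) (w : G.V) :
    G.inc w g = (if w = a then 1 else 0) + (if w = b then 1 else 0) := by
  unfold inc
  rw [hg, Sym2.diag]
  simp only [Sym2.eq_iff, Sym2.mem_iff]
  grind

theorem exists_ends (G : Multigraph) (g : G.E) : ∃ a b, G.ends g = s(a, b) := by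
  induction h : G.ends g with
  | _ a b => exact ⟨a, b, rfl⟩

/-- The number of ends of the edge `g` in `A` (a loop has two ends). -/
def endsIn (G : Multigraph) (A : Finset G.V) (g : G.E) : ℕ := ∑ v ∈ A, G.inc v g

theorem endsIn_eq (G : Multigraph) (A : Finset G.V) {g : G.E} {a b : G.V}
    (hg : G.ends g = s(a, b)) :
    G.endsIn A g = (if a ∈ A then 1 else 0) + (if b ∈ A then 1 else 0) := by
  simp [endsIn, G.inc_eq hg, Finset.sum_add_distrib]

theorem IsCubic.sum_endsIn {G : Multigraph} (hG : G.IsCubic) (A : Finset G.V) :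
    ∑ g, G.endsIn A g = 3 * A.card := by
  simp only [endsIn]
  rw [Finset.sum_comm]
  change ∑ v ∈ A, G.degree v = _
  rw [Finset.sum_congr rfl fun v _ => hG v]
  simp [mul_comm]

theorem mem_cutEdges_iff (G : Multigraph) (A : Set G.V) {g : G.E} {a b : G.V}
    (hg : G.ends g = s(a, b)) :
    g ∈ G.cutEdges A ↔ (a ∈ A ∧ b ∉ A) ∨ (b ∈ A ∧ a ∉ A) := by
  simp only [cutEdges, Set.mem_ofPred_eq, hg, Sym2.eq_iff]
  grind

theorem cutEdges_compl (G : Multigraph) (A : Set G.V) : G.cutEdges Aᶜ = G.cutEdges A := by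
  ext g
  obtain ⟨a, b, hg⟩ := G.exists_ends g
  rw [G.mem_cutEdges_iff _ hg, G.mem_cutEdges_iff _ hg]
  simp only [Set.mem_compl_iff]
  tauto

theorem ncard_cutEdges_eq_sum (G : Multigraph) (A : Set G.V) :
    (G.cutEdges A).ncard = ∑ g, if g ∈ G.cutEdges A then 1 else 0 := by
  rw [Set.ncard_eq_toFinset_card', Finset.sum_boole, Nat.cast_id]
  congr 1
  ext
  simp

theorem hasCycleWithin_of_card_le (G : Multigraph) (A : Finset G.V) (F : Finset G.E)
    (hF : F.Nonempty) (hFA : ∀ g ∈ F, ∀ v ∈ G.ends g, v ∈ A) (hcard : A.card ≤ F.card) :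
    G.HasCycleWithin A := by
  induction hn : F.card generalizing A F with
  | zero => simp_all
  | succ n ih =>
    by_cases hall : ∀ v : G.V, (∑ g ∈ F, G.inc v g) ≠ 1
    · exact ⟨F, hF, by simpa using hFA, hall⟩
    push Not at hall
    obtain ⟨v, hv⟩ := hall
    have hpos : ∃ g ∈ F, G.inc v g ≠ 0 := by
      by_contra! h0
      rw [Finset.sum_eq_zero h0] at hv
      omega
    obtain ⟨g, hgF, hg0⟩ := hpos
    have hsplit := Finset.add_sum_erase F (G.inc v) hgF
    have hg1 : G.inc v g = 1 := by omega
    have hrest : ∀ k ∈ F.erase g, G.inc v k = 0 := by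
      rw [← Finset.sum_eq_zero_iff]
      omega
    obtain ⟨a, b, hab⟩ := G.exists_ends g
    have hgA := hFA g hgF
    rw [hab] at hgA
    have haA : a ∈ A := hgA a (Sym2.mem_mk_left _ _)
    have hbA : b ∈ A := hgA b (Sym2.mem_mk_right _ _)
    rw [G.inc_eq hab] at hg1
    have hvA : v ∈ A := by grind
    have hA2 : 1 < A.card := Finset.one_lt_card.2 ⟨a, haA, b, hbA, by grind⟩
    have hFc := Finset.card_erase_of_mem hgF
    have hAc := Finset.card_erase_of_mem hvA
    obtain ⟨F', hF', hF'A, hF'v⟩ := ih (A.erase v) (F.erase g)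
      (Finset.card_pos.1 (by omega)) (by
        intro k hk w hw
        refine Finset.mem_erase.2 ⟨?_, hFA k (Finset.mem_of_mem_erase hk) w hw⟩
        rintro rfl
        have := hrest k hk
        obtain ⟨c, d, hcd⟩ := G.exists_ends k
        rw [G.inc_eq hcd] at this
        rw [hcd, Sym2.mem_iff] at hw
        grind) (by omega) (by omega)
    exact ⟨F', hF', fun k hk w hw => Finset.mem_of_mem_erase (hF'A k hk w hw), hF'v⟩

theorem IsCubic.hasCycleWithin {G : Multigraph} (hG : G.IsCubic) {A : Finset G.V}
    (hA : A.Nonempty) (hcut : (G.cutEdges A).ncard ≤ A.card + 1) : G.HasCycleWithin A := by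
  set F : Finset G.E := Finset.univ.filter fun g => ∀ v ∈ G.ends g, v ∈ A with hF
  have hsum : ∑ g, G.endsIn A g = 2 * F.card + (G.cutEdges A).ncard := by
    rw [G.ncard_cutEdges_eq_sum, hF, Finset.card_filter, Finset.mul_sum, ← Finset.sum_add_distrib]
    refine Finset.sum_congr rfl fun g _ => ?_
    obtain ⟨a, b, hg⟩ := G.exists_ends g
    simp only [G.endsIn_eq A hg, G.mem_cutEdges_iff _ hg, hg, Sym2.mem_iff, forall_eq_or_imp,
      forall_eq, Finset.mem_coe]
    grind
  rw [hG.sum_endsIn] at hsum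
  have hpos := hA.card_pos
  exact G.hasCycleWithin_of_card_le A F (Finset.card_pos.1 (by omega))
    (fun g hg => (Finset.mem_filter.1 hg).2) (by omega)

theorem CyclicallyEdgeConnected.card_add_two_le {G : Multigraph} (hG : G.IsCubic) {k : ℕ}
    (hk : G.CyclicallyEdgeConnected k) {A : Finset G.V} (hA : A.Nonempty) (hA' : Aᶜ.Nonempty)
    (hcut : (G.cutEdges A).ncard < k) :
    A.card + 2 ≤ (G.cutEdges A).ncard ∨ Aᶜ.card + 2 ≤ (G.cutEdges A).ncard := by
  by_contra! h
  have h' : (G.cutEdges (Aᶜ : Finset G.V)).ncard = (G.cutEdges A).ncard := by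
    rw [Finset.coe_compl, cutEdges_compl]
  have h1 := hG.hasCycleWithin hA (by omega)
  have h2 := hG.hasCycleWithin hA' (by omega)
  rw [Finset.coe_compl] at h2
  exact absurd (hk A ⟨h1, h2⟩) (by omega)

theorem CyclicallyEdgeConnected.three_le_cut {G : Multigraph} (hG : G.IsCubic)
    (h5 : G.CyclicallyEdgeConnected 5) {A : Finset G.V} (hA : A.Nonempty) (hA' : Aᶜ.Nonempty) :
    3 ≤ (G.cutEdges A).ncard := by
  by_contra! h
  have := h5.card_add_two_le hG hA hA' (by omega)
  have := hA.card_pos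
  have := hA'.card_pos
  omega

theorem IsCubic.even_card {G : Multigraph} (hG : G.IsCubic) : Even (Nat.card G.V) := by
  have h := hG.sum_endsIn Finset.univ
  have h2 : ∀ g, G.endsIn Finset.univ g = 2 := by
    intro g
    obtain ⟨a, b, hg⟩ := G.exists_ends g
    simp [G.endsIn_eq _ hg]
  simp only [h2, Finset.sum_const, smul_eq_mul, Finset.card_univ] at h
  rw [Nat.card_eq_fintype_card, Nat.even_iff]
  omega

theorem CyclicallyEdgeConnected.ne_of_ends {G : Multigraph} (hG : G.IsCubic)
    (h5 : G.CyclicallyEdgeConnected 5) {g : G.E} {a b : G.V} (hg : G.ends g = s(a, b)) :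
    a ≠ b := by
  rintro rfl
  have hA' : ({a} : Finset G.V)ᶜ.Nonempty := by
    rw [← Finset.card_pos, Finset.card_compl, Finset.card_singleton]
    have := hG.even_card
    rw [Nat.card_eq_fintype_card, Nat.even_iff] at this
    have : 0 < Fintype.card G.V := Fintype.card_pos_iff.2 ⟨a⟩
    omega
  have h3 := h5.three_le_cut hG (Finset.singleton_nonempty a) hA'
  have hle : (G.cutEdges ({a} : Finset G.V)).ncard + 2 ≤ ∑ k, G.endsIn {a} k := by
    rw [G.ncard_cutEdges_eq_sum, ← Finset.add_sum_erase _ _ (Finset.mem_univ g),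
      ← Finset.add_sum_erase _ (G.endsIn {a}) (Finset.mem_univ g), G.endsIn_eq _ hg,
      G.mem_cutEdges_iff _ hg]
    have : ∀ k ∈ Finset.univ.erase g,
        (if k ∈ G.cutEdges ({a} : Finset G.V) then 1 else 0) ≤ G.endsIn {a} k := by
      intro k _
      obtain ⟨c, d, hk⟩ := G.exists_ends k
      simp only [G.endsIn_eq _ hk, G.mem_cutEdges_iff _ hk, Finset.mem_coe]
      grind
    have := Finset.sum_le_sum this
    simp only [Finset.mem_coe, Finset.mem_singleton, and_not_self, or_self, reduceIte]
    omega
  rw [hG.sum_endsIn, Finset.card_singleton] at hle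
  omega

/-- In a cyclically 5-edge-connected cubic graph, if no perfect matching contains `f` and avoids
`e`, then deleting `e` and `f` leaves a balanced bipartite graph, with both ends of `f` in one class
and both ends of `e` in the other. -/
theorem exists_balanced_classes {G : Multigraph} (hG : G.IsCubic)
    (h5 : G.CyclicallyEdgeConnected 5) {e f : G.E} (hfe : f ≠ e)
    (hno : ¬ ∃ M, (G.deleteEdges {e}).IsPerfectMatching M ∧ ∃ f' ∈ M, f'.1 = f) :
    ∃ S : Finset G.V, (∀ v ∈ G.ends f, v ∈ S) ∧ (∀ v ∈ G.ends e, v ∉ S) ∧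
      (∀ g, g ≠ e → g ≠ f → ∃ a b, G.ends g = s(a, b) ∧ a ∈ S ∧ b ∉ S) ∧
      Sᶜ.card = S.card := by
  obtain ⟨x, y, hf⟩ := G.exists_ends f
  obtain ⟨u, v, he⟩ := G.exists_ends e
  have hxy := h5.ne_of_ends hG hf
  obtain ⟨S, ι, _, C, hxS, hyS, hC, hdisj, hCS, hadj, hcard⟩ :=
    (G.deleteEdges {e}).exists_pieces_of_no_perfectMatching (f := ⟨f, hfe⟩) hG.even_card hf hxy
      (fun ⟨M, hM, hfM⟩ => hno ⟨M, hM, _, hfM, rfl⟩)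
  change Finset G.V at S
  change ι → Finset G.V at C
  replace hxS : x ∈ S := hxS
  replace hyS : y ∈ S := hyS
  replace hcard : S.card ≤ Fintype.card ι := hcard
  replace hadj : ∀ g, g ≠ e → ∀ a b, G.ends g = s(a, b) → ∀ i, a ∈ C i → b ∈ C i ∨ b ∈ S :=
    fun g hg a b hab i ha => hadj i a ha b ⟨⟨g, hg⟩, hab⟩
  -- `c a` is the number of pieces containing `a`.
  let c : G.V → ℕ := fun a => ∑ i, if a ∈ C i then 1 else 0
  let N : G.E → ℕ := fun g => ∑ i, if g ∈ G.cutEdges (C i) then 1 else 0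
  have hc1 : ∀ a, c a ≤ 1 := by
    intro a
    simp only [c, Finset.sum_boole, Nat.cast_id, Finset.card_le_one, Finset.mem_filter]
    exact fun i hi j hj => hdisj i j a hi.2 hj.2
  have hc0 : ∀ a, (∀ i, a ∉ C i) → c a = 0 := by
    intro a ha
    simp [c, ha]
  have hcS : ∀ a ∈ S, c a = 0 := fun a ha => hc0 a fun i hi => hCS i a hi ha
  have hNe : N e ≤ c u + c v := by
    simp only [N, c]
    rw [← Finset.sum_add_distrib]
    refine Finset.sum_le_sum fun i _ => ?_
    simp only [G.mem_cutEdges_iff _ he, Finset.mem_coe]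
    grind
  have hN : ∀ g, g ≠ e → ∀ a b, G.ends g = s(a, b) →
      N g ≤ (if b ∈ S then c a else 0) + (if a ∈ S then c b else 0) := by
    intro g hg a b hab
    have h1 := hadj g hg a b hab
    have h2 := hadj g hg b a (by rw [hab, Sym2.eq_swap])
    have h3 : ∀ i, (if g ∈ G.cutEdges (C i) then 1 else 0) ≤
        (if b ∈ S then (if a ∈ C i then 1 else 0) else 0) +
        (if a ∈ S then (if b ∈ C i then 1 else 0) else 0) := by
      intro i
      simp only [G.mem_cutEdges_iff _ hab, Finset.mem_coe]
      grind
    refine (Finset.sum_le_sum fun i _ => h3 i).trans ?_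
    rw [Finset.sum_add_distrib]
    simp only [c]
    split_ifs <;> simp
  have hle : ∀ g, N g + (if g = f then 2 else 0) ≤ G.endsIn S g + (if g = e then 2 else 0) := by
    intro g
    by_cases hge : g = e
    · subst hge
      have := hc1 u
      have := hc1 v
      rw [if_neg hfe.symm, if_pos rfl]
      omega
    · by_cases hgf : g = f
      · subst hgf
        have := hN g hge x y hf
        rw [hcS x hxS, hcS y hyS] at this
        simp only [ite_self] at this
        rw [G.endsIn_eq S hf, if_pos hxS, if_pos hyS, if_pos rfl]
        omega
      · obtain ⟨a, b, hab⟩ := G.exists_ends g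
        have := hN g hge a b hab
        have := hc1 a
        have := hc1 b
        rw [G.endsIn_eq S hab, if_neg hgf, if_neg hge]
        split_ifs at * <;> omega
  have hCc : ∀ i, (C i)ᶜ.Nonempty := fun i =>
    ⟨x, Finset.mem_compl.2 fun hi => hCS i x hi hxS⟩
  have hCcut : ∀ i, 3 ≤ (G.cutEdges (C i)).ncard := fun i => h5.three_le_cut hG (hC i) (hCc i)
  have hNsum : ∑ g, N g = ∑ i, (G.cutEdges (C i)).ncard := by
    simp only [N]
    rw [Finset.sum_comm]
    exact Finset.sum_congr rfl fun i _ => (G.ncard_cutEdges_eq_sum _).symm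
  have hlow : ∑ _i : ι, 3 ≤ ∑ i, (G.cutEdges (C i)).ncard := Finset.sum_le_sum fun i _ => hCcut i
  have hlow' : ∑ _i : ι, 3 = 3 * Fintype.card ι := by simp [mul_comm]
  have hL : ∑ g, (N g + (if g = f then 2 else 0)) = ∑ g, N g + 2 := by
    simp [Finset.sum_add_distrib]
  have hR : ∑ g, (G.endsIn S g + (if g = e then 2 else 0)) = 3 * S.card + 2 := by
    simp [Finset.sum_add_distrib, hG.sum_endsIn]
  have hup := Finset.sum_le_sum fun g (_ : g ∈ Finset.univ) => hle g
  have heq : ∀ g, N g + (if g = f then 2 else 0) = G.endsIn S g + (if g = e then 2 else 0) := by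
    have := (Finset.sum_eq_sum_iff_of_le fun g (_ : g ∈ Finset.univ) => hle g).1 (by omega)
    simpa using this
  have hcut3 : ∀ i, 3 = (G.cutEdges (C i)).ncard := by
    have := (Finset.sum_eq_sum_iff_of_le fun i (_ : i ∈ Finset.univ) => hCcut i).1 (by omega)
    simpa using this
  have hsingle : ∀ i, (C i).card ≤ 1 := by
    intro i
    have hi := hcut3 i
    have h2 : 2 ≤ (C i)ᶜ.card := by
      rw [← Finset.card_pair hxy]
      refine Finset.card_le_card fun w hw => Finset.mem_compl.2 fun hwi => hCS i w hwi ?_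
      simp only [Finset.mem_insert, Finset.mem_singleton] at hw
      rcases hw with rfl | rfl <;> assumption
    rcases h5.card_add_two_le hG (hC i) (hCc i) (by omega) with h | h <;> omega
  have hee := heq e
  rw [if_neg hfe.symm, if_pos rfl, G.endsIn_eq S he] at hee
  have hu1 := hc1 u
  have hv1 := hc1 v
  have huS : u ∉ S := fun h => by rw [if_pos h] at hee; omega
  have hvS : v ∉ S := fun h => by rw [if_pos h] at hee; omega
  rw [if_neg huS, if_neg hvS] at hee
  have hcover : ∀ w ∉ S, ∃ i, w ∈ C i := by
    by_contra! ⟨w, hwS, hwC⟩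
    set R : Finset G.V := Finset.univ.filter fun w => w ∉ S ∧ ∀ i, w ∉ C i with hRdef
    have hRmem : ∀ w, w ∈ R ↔ w ∉ S ∧ ∀ i, w ∉ C i := by simp [hRdef]
    have h3 := h5.three_le_cut hG (A := R) ⟨w, (hRmem w).2 ⟨hwS, hwC⟩⟩
      ⟨x, Finset.mem_compl.2 fun h => ((hRmem x).1 h).1 hxS⟩
    obtain ⟨g, a, b, hab, haR, hbR⟩ := Set.nonempty_of_ncard_ne_zero (by omega :
      (G.cutEdges R).ncard ≠ 0)
    obtain ⟨haS, haC⟩ := (hRmem a).1 haR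
    have hge : g ≠ e := by
      rintro rfl
      have hca := hc0 a haC
      rw [he, Sym2.eq_iff] at hab
      rcases hab with ⟨rfl, rfl⟩ | ⟨rfl, rfl⟩ <;> omega
    have hgf : g ≠ f := by
      rintro rfl
      rw [hf, Sym2.eq_iff] at hab
      rcases hab with ⟨rfl, rfl⟩ | ⟨rfl, rfl⟩ <;> exact haS ‹_›
    have hbS : b ∈ S := by
      by_contra hbS
      refine hbR ((hRmem b).2 ⟨hbS, fun i hi => ?_⟩)
      rcases hadj g hge b a (by rw [hab, Sym2.eq_swap]) i hi with h | h
      · exact haC i h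
      · exact haS h
    have hg := heq g
    have hgN := hN g hge a b hab
    rw [if_neg hge, if_neg hgf, G.endsIn_eq S hab, if_pos hbS] at hg
    rw [hc0 a haC, if_neg haS, ite_self] at hgN
    omega
  have hcross : ∀ g, g ≠ e → g ≠ f → ∃ a b, G.ends g = s(a, b) ∧ a ∈ S ∧ b ∉ S := by
    intro g hge hgf
    obtain ⟨a, b, hab⟩ := G.exists_ends g
    by_cases haS : a ∈ S <;> by_cases hbS : b ∈ S
    · have hg := heq g
      have hgN := hN g hge a b hab
      rw [if_neg hge, if_neg hgf, G.endsIn_eq S hab, if_pos hbS, if_pos haS] at hg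
      rw [hcS a haS, hcS b hbS, ite_self, ite_self] at hgN
      omega
    · exact ⟨a, b, hab, haS, hbS⟩
    · exact ⟨b, a, by rw [hab, Sym2.eq_swap], hbS, haS⟩
    · obtain ⟨i, hi⟩ := hcover a haS
      have hbi := (hadj g hge a b hab i hi).resolve_right hbS
      exact absurd (Finset.card_le_one.1 (hsingle i) a hi b hbi) (h5.ne_of_ends hG hab)
  refine ⟨S, ?_, ?_, hcross, ?_⟩
  · simpa [hf] using ⟨hxS, hyS⟩
  · simpa [he] using ⟨huS, hvS⟩
  · have h1 : ∀ g, G.endsIn Sᶜ g + (if g = f then 2 else 0) =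
        G.endsIn S g + (if g = e then 2 else 0) := by
      intro g
      by_cases hge : g = e
      · subst hge
        simp [G.endsIn_eq _ he, huS, hvS, hfe.symm]
      · by_cases hgf : g = f
        · subst hgf
          simp [G.endsIn_eq _ hf, hxS, hyS, hge]
        · obtain ⟨a, b, hab, ha, hb⟩ := hcross g hge hgf
          simp [G.endsIn_eq _ hab, ha, hb, hge, hgf]
    have h2 := Finset.sum_congr rfl fun g (_ : g ∈ Finset.univ) => h1 g
    simp only [Finset.sum_add_distrib, hG.sum_endsIn, Finset.sum_ite_eq', Finset.mem_univ,
      if_true] at h2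
    omega

/-- A balanced bipartite graph in which the neighbourhood of every nonempty `X ⊆ S` missing the
end `a ∈ S` of `g` is larger than `X` has a perfect matching containing `g`. -/
theorem exists_perfectMatching_of_expanding (G : Multigraph) (S : Finset G.V)
    (hS : Sᶜ.card = S.card) {g : G.E} {a b : G.V} (hg : G.ends g = s(a, b)) (ha : a ∈ S)
    (hb : b ∉ S)
    (hexp : ∀ X ⊆ S, X.Nonempty → a ∉ X →
      X.card < (Finset.univ.filter fun t => t ∉ S ∧ ∃ s ∈ X, G.Adj s t).card) :
    ∃ M, G.IsPerfectMatching M ∧ g ∈ M := by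
  let r : {s // s ∈ S} → {t // t ∉ S} → Prop := fun s t => G.Adj s t ∧ (s.1 = a ↔ t.1 = b)
  -- The Hall condition for sets avoiding `a`, with `b` removed from the neighbourhood.
  have hX0 : ∀ X : Finset {s // s ∈ S}, ⟨a, ha⟩ ∉ X →
      X.card ≤ (Finset.univ.filter fun t => ∃ s ∈ X, r s t).card := by
    intro X haX
    rcases X.eq_empty_or_nonempty with rfl | hX
    · simp
    have h := hexp (X.map (Function.Embedding.subtype _))
      (fun v hv => by
        obtain ⟨s, -, rfl⟩ := Finset.mem_map.1 hv
        exact s.2) hX.map (fun hv => by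
        obtain ⟨s, hs, hsa⟩ := Finset.mem_map.1 hv
        exact haX (by convert hs; exact hsa.symm))
    rw [Finset.card_map] at h
    have h2 := (Finset.univ.filter fun t => t ∉ S ∧
      ∃ s ∈ X.map (Function.Embedding.subtype _), G.Adj s t).pred_card_le_card_erase (a := b)
    have h3 : ((Finset.univ.filter fun t => t ∉ S ∧
        ∃ s ∈ X.map (Function.Embedding.subtype _), G.Adj s t).erase b) ⊆
        (Finset.univ.filter fun t => ∃ s ∈ X, r s t).map (Function.Embedding.subtype _) := by
      intro t ht
      simp only [Finset.mem_erase, Finset.mem_filter, Finset.mem_univ, true_and] at ht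
      obtain ⟨htb, htS, s', hs', hst⟩ := ht
      obtain ⟨s, hs, rfl⟩ := Finset.mem_map.1 hs'
      refine Finset.mem_map.2 ⟨⟨t, htS⟩, ?_, rfl⟩
      simp only [Finset.mem_filter, Finset.mem_univ, true_and]
      refine ⟨s, hs, hst, fun hsa => ?_, fun h => absurd h htb⟩
      exact absurd (by convert hs; exact hsa.symm) haX
    have h4 := Finset.card_le_card h3
    rw [Finset.card_map] at h4
    omega
  have hHall : ∀ X : Finset {s // s ∈ S},
      X.card ≤ (Finset.univ.filter fun t => ∃ s ∈ X, r s t).card := by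
    intro X
    by_cases haX : ⟨a, ha⟩ ∈ X
    · have h := hX0 (X.erase ⟨a, ha⟩) (Finset.notMem_erase _ _)
      rw [Finset.card_erase_of_mem haX] at h
      have hlt : (Finset.univ.filter fun t => ∃ s ∈ X.erase ⟨a, ha⟩, r s t).card <
          (Finset.univ.filter fun t => ∃ s ∈ X, r s t).card := by
        refine Finset.card_lt_card (Finset.ssubset_iff.2 ⟨⟨b, hb⟩, ?_, ?_⟩)
        · simp only [Finset.mem_filter, Finset.mem_univ, true_and, not_exists, not_and]
          intro s hs hr
          exact (Finset.mem_erase.1 hs).1 (Subtype.ext (hr.2.2 rfl))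
        · intro t ht
          simp only [Finset.mem_insert, Finset.mem_filter, Finset.mem_univ, true_and] at ht ⊢
          rcases ht with rfl | ⟨s, hs, hr⟩
          · exact ⟨⟨a, ha⟩, haX, ⟨g, hg⟩, by simp⟩
          · exact ⟨s, Finset.mem_of_mem_erase hs, hr⟩
      omega
    · exact hX0 X haX
  obtain ⟨φ, hφ, hr⟩ := (Fintype.all_card_le_filter_rel_iff_exists_injective r).1 hHall
  have hbij : Function.Bijective φ := by
    rw [Fintype.bijective_iff_injective_and_card]
    refine ⟨hφ, ?_⟩
    rw [Fintype.card_coe, Fintype.card_subtype_compl, Fintype.card_coe, ← hS, Finset.card_compl]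
    have := Finset.card_compl S
    omega
  let ψ := Equiv.ofBijective φ hbij
  have hψ : ∀ s : {s // s ∈ S}, G.Adj s (ψ s) := fun s => (hr s).1
  have hψa : (ψ ⟨a, ha⟩ : G.V) = b := ((hr ⟨a, ha⟩).2).1 rfl
  let p : G.V → G.V := fun v => if h : v ∈ S then ψ ⟨v, h⟩ else ψ.symm ⟨v, h⟩
  have hp1 : ∀ s : {s // s ∈ S}, p s = ψ s := fun s => by simp [p]
  have hp2 : ∀ s : {s // s ∈ S}, p (ψ s) = s := fun s => by simp [p, (ψ s).2]
  have hcases : ∀ v : G.V, (∃ s : {s // s ∈ S}, v = s) ∨ ∃ s : {s // s ∈ S}, v = ψ s := by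
    intro v
    by_cases h : v ∈ S
    · exact Or.inl ⟨⟨v, h⟩, rfl⟩
    · exact Or.inr ⟨ψ.symm ⟨v, h⟩, by simp⟩
  have hne : ∀ s : {s // s ∈ S}, (ψ s : G.V) ≠ s := fun s h => (ψ s).2 (h ▸ s.2)
  refine G.exists_perfectMatching_of_involution p ?_ ?_ ?_ g a (by rw [hg, hp1 ⟨a, ha⟩, hψa])
  · intro v
    rcases hcases v with ⟨s, rfl⟩ | ⟨s, rfl⟩
    · rw [hp1, hp2]
    · rw [hp2, hp1]
  · intro v
    rcases hcases v with ⟨s, rfl⟩ | ⟨s, rfl⟩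
    · rw [hp1]; exact hne s
    · rw [hp2]; exact (hne s).symm
  · intro v
    rcases hcases v with ⟨s, rfl⟩ | ⟨s, rfl⟩
    · rw [hp1]; exact hψ s
    · rw [hp2]
      obtain ⟨k, hk⟩ := hψ s
      exact ⟨k, by rw [hk, Sym2.eq_swap]⟩

theorem CyclicallyEdgeConnected.card_lt_card_neighbors {G : Multigraph} (hG : G.IsCubic)
    (h5 : G.CyclicallyEdgeConnected 5) {e f : G.E} {S : Finset G.V}
    (hf : ∀ v ∈ G.ends f, v ∈ S) (he : ∀ v ∈ G.ends e, v ∉ S)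
    (hcross : ∀ g, g ≠ e → g ≠ f → ∃ a b, G.ends g = s(a, b) ∧ a ∈ S ∧ b ∉ S)
    {X : Finset G.V} (hXS : X ⊆ S) (hX : X.Nonempty) (hXne : X ≠ S) :
    X.card < (Finset.univ.filter fun t => t ∉ S ∧
      ∃ s ∈ X, (G.deleteEdges {e, f}).Adj s t).card := by
  by_contra! hle
  set Y : Finset G.V := Finset.univ.filter fun t => t ∉ S ∧
      ∃ s ∈ X, (G.deleteEdges {e, f}).Adj s t with hY
  have hYmem : ∀ t, t ∈ Y ↔ t ∉ S ∧ ∃ s ∈ X, (G.deleteEdges {e, f}).Adj s t := by simp [hY]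
  obtain ⟨z, hzS, hzX⟩ := Finset.exists_of_ssubset (hXS.ssubset_of_ne hXne)
  have h3 := h5.three_le_cut hG (A := X ∪ Y) (hX.mono Finset.subset_union_left)
    ⟨z, by simp [hzX, hYmem, hzS]⟩
  have hterm : ∀ g, G.endsIn X g + (if g ∈ G.cutEdges (X ∪ Y : Finset G.V) then 1 else 0) ≤
      G.endsIn Y g + (if g = f then 2 else 0) := by
    intro g
    obtain ⟨a, b, hab⟩ := G.exists_ends g
    by_cases hge : g = e
    · subst hge
      have haS := he a (by simp [hab])
      have hbS := he b (by simp [hab])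
      have haX : a ∉ X := fun h => haS (hXS h)
      have hbX : b ∉ X := fun h => hbS (hXS h)
      simp only [G.endsIn_eq _ hab, G.mem_cutEdges_iff _ hab, Finset.mem_coe, Finset.mem_union,
        haX, hbX]
      grind
    · by_cases hgf : g = f
      · subst hgf
        have haY : a ∉ Y := fun h => ((hYmem a).1 h).1 (hf a (by simp [hab]))
        have hbY : b ∉ Y := fun h => ((hYmem b).1 h).1 (hf b (by simp [hab]))
        simp only [G.endsIn_eq _ hab, G.mem_cutEdges_iff _ hab, Finset.mem_coe, Finset.mem_union,
          haY, hbY]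
        grind
      · clear hab
        obtain ⟨a, b, hab, haS, hbS⟩ := hcross g hge hgf
        have haY : a ∉ Y := fun h => ((hYmem a).1 h).1 haS
        have hbX : b ∉ X := fun h => hbS (hXS h)
        have hXY : a ∈ X → b ∈ Y := fun h =>
          (hYmem b).2 ⟨hbS, a, h, ⟨g, by simp [hge, hgf]⟩, hab⟩
        simp only [G.endsIn_eq _ hab, G.mem_cutEdges_iff _ hab, Finset.mem_coe, Finset.mem_union,
          haY, hbX]
        grind
  have hsum := Finset.sum_le_sum fun g (_ : g ∈ Finset.univ) => hterm g
  rw [Finset.sum_add_distrib, Finset.sum_add_distrib, hG.sum_endsIn, hG.sum_endsIn,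
    ← G.ncard_cutEdges_eq_sum] at hsum
  simp only [Finset.sum_ite_eq', Finset.mem_univ, if_true] at hsum
  omega

end Multigraph

/-- Let `G` be a cyclically 5-edge-connected cubic graph and
`e` an edge of `G`. If `G - e` is not matching covered, then `G` contains an
edge `f` such that `G - {e, f}` is matching covered and bipartite. -/
theorem cyclically5ec_deleteEdge_not_matchingCovered (G : Multigraph)
    (hcubic : G.IsCubic) (h5 : G.CyclicallyEdgeConnected 5) (e : G.E)
    (h : ¬ (G.deleteEdges {e}).MatchingCovered) :
    ∃ f : G.E, f ≠ e ∧ (G.deleteEdges {e, f}).MatchingCovered ∧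
      (G.deleteEdges {e, f}).Bipartite := by
  simp only [Multigraph.MatchingCovered, not_forall] at h
  obtain ⟨⟨f, hfe⟩, hno⟩ := h
  obtain ⟨S, hf, he, hcross, hS⟩ := exists_balanced_classes (e := e) hcubic h5 hfe (by
    rintro ⟨M, hM, f', hf', rfl⟩
    exact hno ⟨M, hM, hf'⟩)
  have hcross' : ∀ g : (G.deleteEdges {e, f}).E, ∃ a b, G.ends g.1 = s(a, b) ∧ a ∈ S ∧ b ∉ S := by
    rintro ⟨g, hg⟩
    simp only [Set.mem_insert_iff, Set.mem_singleton_iff, not_or] at hg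
    exact hcross g hg.1 hg.2
  refine ⟨f, hfe, fun g => ?_, (S : Set G.V), hcross'⟩
  obtain ⟨a, b, hab, ha, hb⟩ := hcross' g
  exact (G.deleteEdges {e, f}).exists_perfectMatching_of_expanding S hS hab ha hb
    fun X hXS hX haX => h5.card_lt_card_neighbors hcubic hf he hcross hXS hX
      fun h => haX (h ▸ ha)
end
end

section
/- In a cubic bridgeless graph, every tight edge-cut contains exactly three edges. -/
open scoped Classical

noncomputable section

namespace FractionalMatching

variable {V W : Type} [Fintype V]

/-- The pairing of two square arrays, as the sum of the products of their entries. -/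
def pair (w x : V → V → ℝ) : ℝ := ∑ u, ∑ v, w u v * x u v

/-- The array indicating the ordered pairs that leave `S`. -/
def cutIndicator (S : Finset V) (u v : V) : ℝ := if u ∈ S ∧ v ∉ S then 1 else 0

/-- A point of Edmonds' perfect matching polytope of the complete graph on `V`, as a symmetric
array. -/
structure IsFractional (x : V → V → ℝ) : Prop where
  symm : ∀ u v, x u v = x v u
  diag : ∀ u, x u u = 0
  nonneg : ∀ u v, 0 ≤ x u v
  row : ∀ u, ∑ v, x u v = 1
  odd : ∀ S : Finset V, Odd S.card → 1 ≤ pair (cutIndicator S) x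

/-- `M` is (the partner map of) a perfect matching supported by `x`. -/
def IsMatching (x : V → V → ℝ) (M : V → V) : Prop := ∀ v, M (M v) = v ∧ 0 < x v (M v)

/-- Every linear functional is at least as large on some matching supported by `x` as on `x`. -/
def Dominated (x : V → V → ℝ) : Prop :=
  ∀ w : V → V → ℝ, ∃ M, IsMatching x M ∧ pair w x ≤ ∑ v, w v (M v)

/-- The array obtained by identifying the vertices in each fibre of `π`. -/
def push (π : V → W) (x : V → V → ℝ) (a b : W) : ℝ :=
  if a = b then 0 else ∑ u, ∑ v, if π u = a ∧ π v = b then x u v else 0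

lemma pair_push [Fintype W] (π : V → W) (x : V → V → ℝ) (w : W → W → ℝ) (hw : ∀ a, w a a = 0) :
    pair w (push π x) = pair (fun u v => w (π u) (π v)) x := by
  have h : ∀ a b, w a b * push π x a b =
      ∑ u, ∑ v, if π u = a ∧ π v = b then w a b * x u v else 0 := by
    intro a b
    unfold push
    split_ifs with hab
    · subst hab; simp [hw]
    · simp [Finset.mul_sum]
  unfold pair
  simp_rw [h]
  calc ∑ a, ∑ b, ∑ u, ∑ v, (if π u = a ∧ π v = b then w a b * x u v else 0)
      = ∑ a, ∑ u, ∑ v, ∑ b, (if π u = a ∧ π v = b then w a b * x u v else 0) := by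
        refine Finset.sum_congr rfl fun a _ => ?_
        rw [Finset.sum_comm]
        refine Finset.sum_congr rfl fun u _ => ?_
        rw [Finset.sum_comm]
    _ = ∑ u, ∑ v, ∑ a, ∑ b, (if π u = a ∧ π v = b then w a b * x u v else 0) := by
        rw [Finset.sum_comm]
        refine Finset.sum_congr rfl fun u _ => ?_
        rw [Finset.sum_comm]
    _ = _ := by
        refine Finset.sum_congr rfl fun u _ => Finset.sum_congr rfl fun v _ => ?_
        rw [Finset.sum_eq_single (π u), Finset.sum_eq_single (π v)]
        · simp
        · intro b _ hb; simp [hb.symm]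
        · simp
        · intro a _ ha; simp [ha.symm]
        · simp

lemma pair_cutIndicator_singleton {x : V → V → ℝ} (hd : ∀ u, x u u = 0) (u : V) :
    pair (cutIndicator {u}) x = ∑ v, x u v := by
  unfold pair cutIndicator
  rw [Finset.sum_eq_single u]
  · refine Finset.sum_congr rfl fun v _ => ?_
    by_cases h : v = u
    · subst h; simp [hd]
    · simp [h]
  · intro b _ hb; simp [hb]
  · simp

lemma pair_cutIndicator_push [Fintype W] (π : V → W) (x : V → V → ℝ) (S : Finset W) :
    pair (cutIndicator S) (push π x) =
      pair (cutIndicator (Finset.univ.filter fun v => π v ∈ S)) x := by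
  rw [pair_push _ _ _ (by simp [cutIndicator])]
  simp [cutIndicator, pair]

lemma push_nonneg {x : V → V → ℝ} (hx : ∀ u v, 0 ≤ x u v) (π : V → W) (a b : W) :
    0 ≤ push π x a b := by
  unfold push
  split_ifs
  · exact le_rfl
  · exact Finset.sum_nonneg fun u _ => Finset.sum_nonneg fun v _ => by
      split_ifs
      exacts [hx u v, le_rfl]

lemma push_pos {x : V → V → ℝ} (hx : ∀ u v, 0 ≤ x u v) {π : V → W} {u v : V}
    (huv : 0 < x u v) (hne : π u ≠ π v) : 0 < push π x (π u) (π v) := by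
  have hn : ∀ u' v', 0 ≤ if π u' = π u ∧ π v' = π v then x u' v' else 0 := fun u' v' => by
    split_ifs
    exacts [hx u' v', le_rfl]
  rw [push, if_neg hne]
  refine lt_of_lt_of_le (by simpa using huv)
    ((Finset.single_le_sum (fun v' _ => hn u v') (Finset.mem_univ v)).trans
      (Finset.single_le_sum (f := fun u' => ∑ v', if π u' = π u ∧ π v' = π v then x u' v' else 0)
        (fun u' _ => Finset.sum_nonneg fun v' _ => hn u' v') (Finset.mem_univ u)))

lemma exists_of_push_pos {x : V → V → ℝ} {π : V → W} {a b : W}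
    (h : 0 < push π x a b) : a ≠ b ∧ ∃ u v, π u = a ∧ π v = b ∧ 0 < x u v := by
  unfold push at h
  split_ifs at h with hab
  · exact absurd h (lt_irrefl 0)
  · refine ⟨hab, ?_⟩
    obtain ⟨u, -, hu⟩ := Finset.exists_lt_of_sum_lt (s := Finset.univ) (f := fun _ : V => (0 : ℝ))
      (by simpa using h)
    obtain ⟨v, -, hv⟩ := Finset.exists_lt_of_sum_lt (s := Finset.univ) (f := fun _ : V => (0 : ℝ))
      (by simpa using hu)
    by_cases hc : π u = a ∧ π v = b
    · rw [if_pos hc] at hv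
      exact ⟨u, v, hc.1, hc.2, hv⟩
    · rw [if_neg hc] at hv
      exact absurd hv (lt_irrefl 0)

lemma isFractional_push [Fintype W] {x : V → V → ℝ} (hx : IsFractional x) (π : V → W)
    (hodd : ∀ a, Odd (Finset.univ.filter fun v => π v = a).card)
    (htight : ∀ a, pair (cutIndicator (Finset.univ.filter fun v => π v = a)) x = 1) :
    IsFractional (push π x) where
  symm a b := by
    by_cases h : a = b
    · rw [h]
    · rw [push, push, if_neg h, if_neg (Ne.symm h),
        Finset.sum_comm]
      refine Finset.sum_congr rfl fun u _ => Finset.sum_congr rfl fun v _ => ?_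
      simp only [hx.symm u v, and_comm]
  diag a := by simp [push]
  nonneg := push_nonneg hx.nonneg π
  row a := by
    rw [← pair_cutIndicator_singleton (by simp [push]), pair_cutIndicator_push]
    simpa using htight a
  odd S hS := by
    rw [pair_cutIndicator_push]
    refine hx.odd _ ?_
    rw [Finset.card_eq_sum_card_fiberwise (f := π) (t := S) (by intro v hv; simpa using hv),
      Finset.odd_sum_iff_odd_card_odd]
    convert hS using 2
    refine Finset.filter_true_of_mem fun a ha => ?_
    convert hodd a using 2
    ext v
    simp only [Finset.mem_filter, Finset.mem_univ, true_and]
    exact ⟨fun h => h.2, fun h => ⟨h ▸ ha, h⟩⟩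

/-- Contraction of the complement of `T` to the single vertex `none`. -/
def collapse {V : Type} (T : Finset V) (v : V) : Option T := if h : v ∈ T then some ⟨v, h⟩ else none

lemma collapse_eq_none {V : Type} {T : Finset V} {v : V} : collapse T v = none ↔ v ∉ T := by
  simp [collapse]

lemma collapse_eq_some {V : Type} {T : Finset V} {v : V} {p : T} : collapse T v = some p ↔ v = p := by
  unfold collapse
  split_ifs with h
  · simp [Subtype.ext_iff]
  · simp only [false_iff]
    rintro rfl
    exact h p.2

lemma IsFractional.push_collapse {x : V → V → ℝ} (hx : IsFractional x) {T : Finset V}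
    (hodd : Odd Tᶜ.card) (htight : pair (cutIndicator Tᶜ) x = 1) :
    IsFractional (push (collapse T) x) := by
  refine isFractional_push hx _ ?_ ?_
  · rintro (_ | p)
    · convert hodd using 3
      ext v; simp [collapse_eq_none]
    · rw [Finset.card_eq_one.2 ⟨(p : V), by ext v; simp [collapse_eq_some]⟩]
      exact odd_one
  · rintro (_ | p)
    · convert htight using 3
      ext v; simp [collapse_eq_none]
    · rw [← hx.row p, ← pair_cutIndicator_singleton hx.diag]
      congr 2
      ext v; simp [collapse_eq_some]

lemma exists_value {x : V → V → ℝ} (hx : IsFractional x) {T : Finset V}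
    (hD : Dominated (push (collapse T) x)) (w : V → V → ℝ) :
    ∃ a : V → ℝ,
      pair (fun u v => if u ∈ T ∧ v ∈ T then w u v else 0) x ≤
        pair (fun u v => if u ∉ T ∧ v ∈ T then a v else 0) x ∧
      ∀ b ∈ T, (∃ u, u ∉ T ∧ 0 < x u b) → ∃ m : V → V,
        (∀ v ∈ T, v ≠ b → m v ∈ T ∧ m v ≠ b ∧ m (m v) = v ∧ 0 < x v (m v)) ∧
        a b ≤ ∑ v ∈ T, if v = b then 0 else w v (m v) := by
  set y := push (collapse T) x with hy
  set c : (Option T → Option T) → ℝ := fun M => ∑ p : T, (M (some p)).elim 0 fun q => w p q with hc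
  have hex : ∀ b : T, (∃ u, u ∉ T ∧ 0 < x u b) → ∃ M, (IsMatching y M ∧ M none = some b) ∧
      ∀ M', IsMatching y M' ∧ M' none = some b → c M' ≤ c M := by
    rintro b ⟨u, hu, hub⟩
    have hpos : 0 < y none (some b) := by
      have hb : collapse T b = some b := collapse_eq_some.2 rfl
      have hu' : collapse T u = none := collapse_eq_none.2 hu
      have := push_pos (π := collapse T) hx.nonneg hub (by rw [hb, hu']; simp)
      rwa [hb, hu'] at this
    obtain ⟨M, hM, hle⟩ := hD fun p q => if p = none ∧ q = some b then 1 else 0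
    have hMb : M none = some b := by
      by_contra hne
      have h1 : pair (fun p q : Option T => if p = none ∧ q = some b then (1 : ℝ) else 0) y
          = y none (some b) := by
        simp [pair, ite_and]
      have h2 : ∑ p : Option T, (if p = none ∧ M p = some b then (1 : ℝ) else 0) = 0 := by
        simp [hne]
      rw [h1, h2] at hle
      exact absurd hle (not_le.2 hpos)
    obtain ⟨M', h1, h2⟩ := Set.exists_max_image {M | IsMatching y M ∧ M none = some b} c
      (Set.toFinite _) ⟨M, hM, hMb⟩
    exact ⟨M', h1, h2⟩
  choose! N hN using hex
  refine ⟨fun v => if h : v ∈ T then c (N ⟨v, h⟩) else 0, ?_, ?_⟩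
  · obtain ⟨M, hM, hle⟩ := hD fun p q => p.elim (q.elim 0 fun b => - c (N b))
      fun p => q.elim 0 fun q => if p = q then 0 else w p q
    rw [pair_push _ _ _ (by rintro (_ | _) <;> simp)] at hle
    obtain ⟨b, hb⟩ : ∃ b, M none = some b := by
      rw [← Option.ne_none_iff_exists']
      intro h
      exact (exists_of_push_pos (hM none).2).1 h.symm
    have hcM : ∑ p : Option T, (p.elim ((M p).elim 0 fun b => - c (N b))
        fun p' => (M p).elim 0 fun q => if p' = q then 0 else w p' q) = - c (N b) + c M := by
      rw [Fintype.sum_option]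
      simp only [Option.elim_none, Option.elim_some, hb, hc]
      congr 1
      refine Finset.sum_congr rfl fun p _ => ?_
      rcases hq : M (some p) with _ | q
      · rfl
      · have := (exists_of_push_pos (hM (some p)).2).1
        rw [hq] at this
        have h' : p ≠ q := fun h => this (by rw [h])
        simp [h']
    rw [hcM] at hle
    have hbpos : ∃ u, u ∉ T ∧ 0 < x u b := by
      have h := (hM none).2
      rw [hb] at h
      obtain ⟨-, u, v, hu, hv, huv⟩ := exists_of_push_pos h
      exact ⟨u, collapse_eq_none.1 hu, collapse_eq_some.1 hv ▸ huv⟩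
    have hmax := (hN b hbpos).2 M ⟨hM, hb⟩
    have hle0 := hle.trans (by linarith : - c (N b) + c M ≤ 0)
    rw [← sub_nonpos]
    refine le_trans (le_of_eq ?_) hle0
    unfold pair
    simp_rw [← Finset.sum_sub_distrib, ← sub_mul]
    refine Finset.sum_congr rfl fun u _ => Finset.sum_congr rfl fun v _ => ?_
    by_cases huv : u = v
    · subst huv; simp [hx.diag]
    · by_cases hu : u ∈ T <;> by_cases hv : v ∈ T <;> simp [collapse, hu, hv, huv]
  · intro b hbT hb
    obtain ⟨⟨hM, hMb⟩, -⟩ := hN ⟨b, hbT⟩ hb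
    set M := N ⟨b, hbT⟩ with hMdef
    set m : V → V := fun v => if h : v ∈ T then (M (some ⟨v, h⟩)).elim v (fun q => (q : V)) else v
      with hm
    have key : ∀ v (hv : v ∈ T), v ≠ b → ∃ q : T, M (some ⟨v, hv⟩) = some q ∧ m v = q := by
      intro v hv hvb
      rcases hq : M (some ⟨v, hv⟩) with _ | q
      · exfalso
        have h1 := (hM (some ⟨v, hv⟩)).1
        rw [hq, hMb] at h1
        exact hvb (by simpa using h1.symm)
      · exact ⟨q, rfl, by simp [hm, hv, hq]⟩
    refine ⟨m, ?_, ?_⟩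
    · intro v hv hvb
      obtain ⟨q, hq, hmq⟩ := key v hv hvb
      have h1 := (hM (some ⟨v, hv⟩)).1
      have h2 := (hM (some ⟨v, hv⟩)).2
      rw [hq] at h1 h2
      have hqb : (q : V) ≠ b := by
        rintro rfl
        have h3 := (hM none).1
        rw [hMb, h1] at h3
        exact absurd h3 (by simp)
      refine ⟨hmq ▸ q.2, hmq ▸ hqb, ?_, ?_⟩
      · rw [hmq]
        simp [hm, h1]
      · rw [hmq]
        obtain ⟨-, u, v', hu, hv', huv⟩ := exists_of_push_pos h2
        rw [collapse_eq_some] at hu hv'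
        rwa [hu, hv'] at huv
    · simp only [hbT, dif_pos]
      refine le_of_eq ?_
      rw [← Finset.sum_coe_sort T]
      refine Finset.sum_congr rfl fun p _ => ?_
      by_cases hpb : (p : V) = b
      · have h1 := (hM none).1
        rw [hMb] at h1
        have : p = ⟨b, hbT⟩ := Subtype.ext hpb
        subst this
        simp [← hMdef, h1]
      · obtain ⟨q, hq, hmq⟩ := key p p.2 hpb
        simp [← hMdef, hq, hmq, hpb]

lemma exists_pos_of_pair_cutIndicator_eq_one {x F : V → V → ℝ} (hx : ∀ u v, 0 ≤ x u v)
    {T : Finset V} (htight : pair (cutIndicator T) x = 1) {R : ℝ}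
    (hR : R ≤ pair (fun u v => if u ∈ T ∧ v ∉ T then F u v else 0) x) :
    ∃ u ∈ T, ∃ v ∉ T, 0 < x u v ∧ R ≤ F u v := by
  by_contra! h
  have hnn : ∀ u v, 0 ≤ (if u ∈ T ∧ v ∉ T then R - F u v else 0) * x u v := by
    intro u v
    split_ifs with huv
    · rcases (hx u v).eq_or_lt with h0 | h0
      · simp [← h0]
      · exact mul_nonneg (sub_nonneg.2 (h u huv.1 v huv.2 h0).le) h0.le
    · simp
  have hsum : ∑ u, ∑ v, (if u ∈ T ∧ v ∉ T then R - F u v else 0) * x u v ≤ 0 := by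
    have : ∑ u, ∑ v, (if u ∈ T ∧ v ∉ T then R - F u v else 0) * x u v =
        R * pair (cutIndicator T) x - pair (fun u v => if u ∈ T ∧ v ∉ T then F u v else 0) x := by
      simp only [pair, Finset.mul_sum, ← Finset.sum_sub_distrib]
      refine Finset.sum_congr rfl fun u _ => Finset.sum_congr rfl fun v _ => ?_
      simp only [cutIndicator]
      split_ifs <;> ring
    rw [this, htight]
    linarith
  have hz : ∀ u v, (if u ∈ T ∧ v ∉ T then R - F u v else 0) * x u v = 0 := by
    intro u v
    refine le_antisymm (le_trans ?_ hsum) (hnn u v)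
    exact (Finset.single_le_sum (fun v' _ => hnn u v') (Finset.mem_univ v)).trans
      (Finset.single_le_sum
        (f := fun u' => ∑ v', (if u' ∈ T ∧ v' ∉ T then R - F u' v' else 0) * x u' v')
        (fun u' _ => Finset.sum_nonneg fun v' _ => hnn u' v') (Finset.mem_univ u))
  have : pair (cutIndicator T) x = 0 := by
    refine Finset.sum_eq_zero fun u _ => Finset.sum_eq_zero fun v _ => ?_
    unfold cutIndicator
    split_ifs with huv
    · rcases (hx u v).eq_or_lt with h0 | h0
      · simp [← h0]
      · have h1 := hz u v
        rw [if_pos huv] at h1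
        exact absurd h1 (mul_pos (sub_pos.2 (h u huv.1 v huv.2 h0)) h0).ne'
    · simp
  linarith

lemma dominated_of_tight {x : V → V → ℝ} (hx : IsFractional x) {T : Finset V}
    (htight : pair (cutIndicator T) x = 1)
    (hT : Dominated (push (collapse T) x)) (hT' : Dominated (push (collapse Tᶜ) x)) :
    Dominated x := by
  intro w
  obtain ⟨a, ha, hm⟩ := exists_value hx hT w
  obtain ⟨a', ha', hm'⟩ := exists_value hx hT' w
  simp only [Finset.mem_compl, not_not] at ha' hm'
  have hswap : ∀ f : V → V → ℝ, pair f x = pair (fun u v => f v u) x := by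
    intro f
    unfold pair
    rw [Finset.sum_comm]
    simp only [hx.symm]
  have hR : pair w x ≤ pair (fun u v => if u ∈ T ∧ v ∉ T then a u + a' v + w u v + w v u else 0) x
      := by
    have h1 : pair w x = pair (fun u v => if u ∈ T ∧ v ∈ T then w u v else 0) x +
        pair (fun u v => if u ∉ T ∧ v ∉ T then w u v else 0) x +
        (pair (fun u v => if u ∈ T ∧ v ∉ T then w u v else 0) x +
        pair (fun u v => if v ∈ T ∧ u ∉ T then w u v else 0) x) := by
      simp only [pair, ← Finset.sum_add_distrib, ← add_mul]
      refine Finset.sum_congr rfl fun u _ => Finset.sum_congr rfl fun v _ => ?_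
      by_cases hu : u ∈ T <;> by_cases hv : v ∈ T <;> simp [hu, hv]
    have h2 : pair (fun u v => if u ∈ T ∧ v ∉ T then a u + a' v + w u v + w v u else 0) x =
        pair (fun u v => if u ∈ T ∧ v ∉ T then a u else 0) x +
        pair (fun u v => if u ∈ T ∧ v ∉ T then a' v else 0) x +
        (pair (fun u v => if u ∈ T ∧ v ∉ T then w u v else 0) x +
        pair (fun u v => if u ∈ T ∧ v ∉ T then w v u else 0) x) := by
      simp only [pair, ← Finset.sum_add_distrib, ← add_mul]
      refine Finset.sum_congr rfl fun u _ => Finset.sum_congr rfl fun v _ => ?_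
      by_cases hu : u ∈ T <;> by_cases hv : v ∈ T <;> simp [hu, hv]
      left; ring
    have h3 : pair (fun u v => if u ∉ T ∧ v ∈ T then a v else 0) x =
        pair (fun u v => if u ∈ T ∧ v ∉ T then a u else 0) x := by
      rw [hswap]; simp only [and_comm]
    have h4 : pair (fun u v => if v ∈ T ∧ u ∉ T then w u v else 0) x =
        pair (fun u v => if u ∈ T ∧ v ∉ T then w v u else 0) x := by
      rw [hswap]
    linarith
  obtain ⟨b, hb, c, hc, hbc, hle⟩ := exists_pos_of_pair_cutIndicator_eq_one hx.nonneg htight hR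
  obtain ⟨m, hm, hma⟩ := hm b hb ⟨c, hc, hx.symm b c ▸ hbc⟩
  obtain ⟨m', hm', hma'⟩ := hm' c hc ⟨b, hb, hbc⟩
  refine ⟨fun v => if v ∈ T then (if v = b then c else m v) else (if v = c then b else m' v),
    ?_, ?_⟩
  · intro v
    by_cases hv : v ∈ T
    · by_cases hvb : v = b
      · subst hvb; simp [hv, hc, hbc]
      · obtain ⟨h1, h2, h3, h4⟩ := hm v hv hvb
        simp [hv, hvb, h1, h2, h3, h4]
    · by_cases hvc : v = c
      · subst hvc; simp [hv, hb, hx.symm v b, hbc]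
      · obtain ⟨h1, h2, h3, h4⟩ := hm' v hv hvc
        simp [hv, hvc, h1, h2, h3, h4]
  · rw [← Finset.sum_add_sum_compl T]
    have h1 : ∑ v ∈ T, w v (if v ∈ T then (if v = b then c else m v) else
        (if v = c then b else m' v)) = w b c + ∑ v ∈ T, if v = b then 0 else w v (m v) := by
      have : w b c = ∑ v ∈ T, if v = b then w b c else 0 := by simp [hb]
      rw [this, ← Finset.sum_add_distrib]
      refine Finset.sum_congr rfl fun v hv => ?_
      by_cases hvb : v = b
      · subst hvb; simp [hv]
      · simp [hv, hvb]
    have h2 : ∑ v ∈ Tᶜ, w v (if v ∈ T then (if v = b then c else m v) else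
        (if v = c then b else m' v)) = w c b + ∑ v ∈ Tᶜ, if v = c then 0 else w v (m' v) := by
      have : w c b = ∑ v ∈ Tᶜ, if v = c then w c b else 0 := by simp [hc]
      rw [this, ← Finset.sum_add_distrib]
      refine Finset.sum_congr rfl fun v hv => ?_
      rw [Finset.mem_compl] at hv
      by_cases hvc : v = c
      · subst hvc; simp [hv]
      · simp [hv, hvc]
    rw [h1, h2]
    linarith

open SimpleGraph in
lemma IsFractional.exists_isMatching {x : V → V → ℝ} (hx : IsFractional x) :
    ∃ M, IsMatching x M := by
  let H : SimpleGraph V :=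
    { Adj := fun u v => 0 < x u v
      symm := ⟨fun u v h => hx.symm u v ▸ h⟩
      loopless := ⟨fun u h => by simp [hx.diag] at h⟩ }
  obtain ⟨M, hM⟩ : ∃ M : H.Subgraph, M.IsPerfectMatching := by
    refine tutte.2 fun U => ?_
    rw [IsTutteViolator, not_lt]
    set H' := ((⊤ : H.Subgraph).deleteVerts U).coe
    have hmem : ∀ v, v ∈ ((⊤ : H.Subgraph).deleteVerts U).verts ↔ v ∉ U := by simp
    let comp : V → Option H'.ConnectedComponent := fun v =>
      if h : v ∉ U then some (H'.connectedComponentMk ⟨v, (hmem v).2 h⟩) else none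
    let part : H'.ConnectedComponent → Finset V := fun K =>
      Finset.univ.filter fun v => comp v = some K
    have : Fintype H'.ConnectedComponent := Fintype.ofFinite _
    have hadj : ∀ u v K, comp u = some K → comp v ≠ some K → v ∉ U → x u v = 0 := by
      intro u v K hu hv hvU
      by_contra hne
      have hpos : 0 < x u v := lt_of_le_of_ne (hx.nonneg u v) (Ne.symm hne)
      have huU : u ∉ U := by
        by_contra h; simp [comp, h] at hu
      simp only [comp, dif_pos huU, dif_pos hvU, Option.some.injEq, ne_eq] at hu hv
      refine hv (hu ▸ ?_)
      refine ConnectedComponent.sound (Adj.reachable ?_)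
      simpa [H', huU, hvU, H, hx.symm] using hpos
    have hcard : ∀ K, (part K).card = K.supp.ncard := by
      intro K
      rw [← Set.ncard_image_of_injective _ Subtype.val_injective, ← Set.ncard_coe_finset]
      congr 1
      ext v
      by_cases hv : v ∈ U <;> simp [part, comp, hv]
    have hone : ∀ K ∈ H'.oddComponents.toFinset,
        (1 : ℝ) ≤ ∑ v ∈ U.toFinset, ∑ u, if comp u = some K then x u v else 0 := by
      intro K hK
      refine (hx.odd (part K) (by rw [hcard]; simpa using hK)).trans ?_
      rw [Finset.sum_comm]
      refine Finset.sum_le_sum fun u _ => ?_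
      rw [← Finset.sum_subset (Finset.subset_univ U.toFinset)]
      · refine Finset.sum_le_sum fun v _ => ?_
        by_cases hu : comp u = some K <;> by_cases hv : comp v = some K <;>
          simp [cutIndicator, part, hu, hv, hx.nonneg]
      · intro v _ hv
        by_cases hc : comp u = some K ∧ comp v ≠ some K
        · rw [hadj u v K hc.1 hc.2 (by simpa using hv), mul_zero]
        · have : cutIndicator (part K) u v = 0 := by
            simpa [cutIndicator, part] using hc
          rw [this, zero_mul]
    have hle : (H'.oddComponents.toFinset.card : ℝ) ≤ U.toFinset.card := by
      calc (H'.oddComponents.toFinset.card : ℝ)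
          = ∑ K ∈ H'.oddComponents.toFinset, (1 : ℝ) := by simp
        _ ≤ ∑ K ∈ H'.oddComponents.toFinset, ∑ v ∈ U.toFinset, ∑ u,
              (if comp u = some K then x u v else 0) := Finset.sum_le_sum hone
        _ = ∑ v ∈ U.toFinset, ∑ u, ∑ K ∈ H'.oddComponents.toFinset,
              (if comp u = some K then x u v else 0) := by
            rw [Finset.sum_comm]
            exact Finset.sum_congr rfl fun v _ => Finset.sum_comm
        _ ≤ ∑ v ∈ U.toFinset, ∑ u, x v u := by
            refine Finset.sum_le_sum fun v _ => Finset.sum_le_sum fun u _ => ?_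
            rw [hx.symm v u]
            rcases hu : comp u with _ | K
            · simp [hx.nonneg]
            · simp only [Option.some.injEq, Finset.sum_ite_eq]
              split_ifs
              exacts [le_rfl, hx.nonneg u v]
        _ = U.toFinset.card := by simp [hx.row]
    rw [Set.ncard_eq_toFinset_card', Set.ncard_eq_toFinset_card']
    exact_mod_cast hle
  rw [Subgraph.isPerfectMatching_iff] at hM
  choose f hf hu using hM
  refine ⟨f, fun v => ⟨?_, M.adj_sub (hf v)⟩⟩
  exact (hu (f v) v (M.symm.symm _ _ (hf v))).symm

/-- The array of the perfect matching with partner map `M`. -/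
def matchingArray (M : V → V) (u v : V) : ℝ := if M u = v then 1 else 0

lemma pair_matchingArray (w : V → V → ℝ) (M : V → V) :
    pair w (matchingArray M) = ∑ v, w v (M v) := by
  simp [pair, matchingArray]

/-- The point `y` with `x = ε • matchingArray M + (1 - ε) • y`. -/
def recede (x : V → V → ℝ) (M : V → V) (ε : ℝ) (u v : V) : ℝ :=
  (x u v - ε * matchingArray M u v) / (1 - ε)

lemma pair_recede (w x : V → V → ℝ) (M : V → V) (ε : ℝ) :
    pair w (recede x M ε) = (pair w x - ε * ∑ v, w v (M v)) / (1 - ε) := by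
  rw [← pair_matchingArray]
  unfold pair recede
  simp only [Finset.mul_sum, ← Finset.sum_sub_distrib, Finset.sum_div]
  refine Finset.sum_congr rfl fun u _ => Finset.sum_congr rfl fun v _ => ?_
  ring

lemma isFractional_recede {x : V → V → ℝ} (hx : IsFractional x) {M : V → V}
    (hM : IsMatching x M) {ε : ℝ} (h1 : ε < 1) (hle : ∀ v, ε ≤ x v (M v))
    (hodd : ∀ S : Finset V, Odd S.card →
      ε * (∑ v, cutIndicator S v (M v) - 1) ≤ pair (cutIndicator S) x - 1) :
    IsFractional (recede x M ε) where
  symm u v := by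
    have : M u = v ↔ M v = u := ⟨fun h => h ▸ (hM u).1, fun h => h ▸ (hM v).1⟩
    simp only [recede, matchingArray, hx.symm u v, this]
  diag u := by
    have : M u ≠ u := fun h => by
      have := (hM u).2
      rw [h, hx.diag] at this
      exact lt_irrefl _ this
    simp [recede, matchingArray, hx.diag, this]
  nonneg u v := by
    refine div_nonneg ?_ (sub_pos.2 h1).le
    unfold matchingArray
    split_ifs with h
    · subst h; linarith [hle u]
    · simpa using hx.nonneg u v
  row u := by
    simp only [recede, ← Finset.sum_div, Finset.sum_sub_distrib, hx.row,
      ← Finset.mul_sum, matchingArray, Finset.sum_ite_eq, Finset.mem_univ, if_true, mul_one]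
    exact div_self (sub_pos.2 h1).ne'
  odd S hS := by
    rw [pair_recede, le_div_iff₀ (sub_pos.2 h1)]
    linarith [hodd S hS]

lemma one_lt_card_of_crossing {M : V → V} (hM : ∀ v, M (M v) = v) {S : Finset V}
    (h : 1 < ∑ v, cutIndicator S v (M v)) : 1 < S.card ∧ 1 < Sᶜ.card := by
  have hsum : ∑ v, cutIndicator S v (M v) =
      ((Finset.univ.filter fun v => v ∈ S ∧ M v ∉ S).card : ℝ) := by
    simp [cutIndicator]
  rw [hsum] at h
  have h' : 1 < (Finset.univ.filter fun v => v ∈ S ∧ M v ∉ S).card := by exact_mod_cast h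
  refine ⟨h'.trans_le (Finset.card_le_card fun v hv => (by simpa using hv : v ∈ S ∧ _).1),
    h'.trans_le (Finset.card_le_card_of_injOn M (fun v hv => ?_) fun u _ v _ huv => ?_)⟩
  · simpa using (by simpa using hv : v ∈ S ∧ M v ∉ S).2
  · rw [← hM u, huv, hM]

lemma IsFractional.even_card {x : V → V → ℝ} (hx : IsFractional x) : Even (Fintype.card V) := by
  by_contra h
  have := hx.odd Finset.univ (by simpa using h)
  norm_num [pair, cutIndicator] at this

/-- Number of nonzero entries. -/
def supportCard (x : V → V → ℝ) : ℕ :=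
  (Finset.univ.filter fun p : V × V => 0 < x p.1 p.2).card

/-- **Edmonds' perfect matching polytope theorem**, in functional form. -/
theorem IsFractional.dominated {V : Type} [Fintype V] {x : V → V → ℝ} (hx : IsFractional x) :
    Dominated x := by
  induction hn : Fintype.card V using Nat.strong_induction_on generalizing V with
  | _ n ihV =>
  subst hn
  have tight : ∀ y : V → V → ℝ, IsFractional y → ∀ S : Finset V, Odd S.card → 1 < S.card →
      1 < Sᶜ.card → pair (cutIndicator S) y = 1 → Dominated y := by
    intro y hy S hS h1 h2 hcut
    have hsum := S.card_add_card_compl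
    have hSc : Odd Sᶜ.card := by
      have := hy.even_card
      rw [← hsum, Nat.even_add'] at this
      exact this.1 hS
    have hcut' : pair (cutIndicator Sᶜ) y = 1 := by
      rw [← hcut]
      unfold pair
      rw [Finset.sum_comm]
      refine Finset.sum_congr rfl fun u _ => Finset.sum_congr rfl fun v _ => ?_
      simp only [cutIndicator, Finset.mem_compl, not_not, hy.symm v u, and_comm]
    refine dominated_of_tight hy hcut ?_ ?_
    · refine ihV _ ?_ (hy.push_collapse hSc hcut') rfl
      simp only [Fintype.card_option, Fintype.card_coe]
      omega
    · refine ihV _ ?_ (hy.push_collapse (by rwa [compl_compl]) (by rwa [compl_compl])) rfl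
      simp only [Fintype.card_option, Fintype.card_coe]
      omega
  induction hk : supportCard x using Nat.strong_induction_on generalizing x with
  | _ k ihx =>
  subst hk
  obtain ⟨M, hM⟩ := hx.exists_isMatching
  have step : ∀ ε : ℝ, 0 ≤ ε → ε < 1 → Dominated (recede x M ε) → Dominated x := by
    intro ε h0 h1 hD w
    by_contra! hw
    obtain ⟨N, hN, hle⟩ := hD w
    have hNx : IsMatching x N := by
      refine fun v => ⟨(hN v).1, ?_⟩
      have h2 := (hN v).2
      unfold recede at h2
      rw [div_pos_iff_of_pos_right (sub_pos.2 h1)] at h2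
      have : 0 ≤ ε * matchingArray M v (N v) := by
        unfold matchingArray
        split_ifs <;> simp [h0]
      linarith
    rw [pair_recede, div_le_iff₀ (sub_pos.2 h1)] at hle
    have h3 := mul_lt_mul_of_pos_right (hw N hNx) (sub_pos.2 h1)
    have h4 := mul_le_mul_of_nonneg_left (hw M hM).le h0
    linarith
  rcases isEmpty_or_nonempty V with hV | hV
  · exact fun w => ⟨M, hM, by simp [pair]⟩
  obtain ⟨v₀, hv₀⟩ := Finite.exists_min fun v => x v (M v)
  have hnn := fun S : Finset V => fun hS => sub_nonneg.2 (hx.odd S hS)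
  have hxle : ∀ u v, x u v ≤ 1 := fun u v => by
    rw [← hx.row u]
    exact Finset.single_le_sum (fun v _ => hx.nonneg u v) (Finset.mem_univ v)
  rcases (hxle v₀ (M v₀)).eq_or_lt with h1 | h1
  · refine fun w => ⟨M, hM, le_of_eq ?_⟩
    rw [← pair_matchingArray]
    congr 1
    ext u v
    have hu : x u (M u) = 1 := le_antisymm (hxle _ _) (h1 ▸ hv₀ u)
    unfold matchingArray
    split_ifs with h
    · rw [← h, hu]
    · have hr := hx.row u
      rw [← Finset.add_sum_erase _ _ (Finset.mem_univ (M u)), hu] at hr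
      have hz := (Finset.sum_eq_zero_iff_of_nonneg fun v _ => hx.nonneg u v).1
        (by linarith : ∑ v ∈ Finset.univ.erase (M u), x u v = 0)
      exact hz v (by simp [Ne.symm h])
  · set cross : Finset V → ℝ := fun S => ∑ v, cutIndicator S v (M v) with hcross
    by_cases hS : ∃ S : Finset V, Odd S.card ∧ 1 < cross S ∧
        pair (cutIndicator S) x - 1 < x v₀ (M v₀) * (cross S - 1)
    · obtain ⟨S, ⟨hSodd, hScr, hSlt⟩, hmin⟩ := Set.exists_min_image
        {S : Finset V | Odd S.card ∧ 1 < cross S ∧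
          pair (cutIndicator S) x - 1 < x v₀ (M v₀) * (cross S - 1)}
        (fun S => (pair (cutIndicator S) x - 1) / (cross S - 1)) (Set.toFinite _) hS
      set ε := (pair (cutIndicator S) x - 1) / (cross S - 1) with hε
      have hSpos : 0 < cross S - 1 := sub_pos.2 hScr
      have hε0 : 0 ≤ ε := div_nonneg (hnn S hSodd) hSpos.le
      have hεlt : ε < x v₀ (M v₀) := by rwa [hε, div_lt_iff₀ hSpos]
      have hε1 := hεlt.trans h1
      have hεS : ε * (cross S - 1) = pair (cutIndicator S) x - 1 := div_mul_cancel₀ _ hSpos.ne'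
      have hfrac : IsFractional (recede x M ε) := by
        refine isFractional_recede hx hM hε1 (fun v => hεlt.le.trans (hv₀ v)) fun S' hS' => ?_
        rcases le_or_gt (cross S') 1 with hc | hc
        · exact (mul_nonpos_of_nonneg_of_nonpos hε0 (sub_nonpos.2 hc)).trans (hnn S' hS')
        · by_cases hlt : pair (cutIndicator S') x - 1 < x v₀ (M v₀) * (cross S' - 1)
          · rw [← le_div_iff₀ (sub_pos.2 hc)]
            exact hmin S' ⟨hS', hc, hlt⟩
          · exact (mul_le_mul_of_nonneg_right hεlt.le (sub_pos.2 hc).le).trans (not_lt.1 hlt)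
      obtain ⟨hc1, hc2⟩ := one_lt_card_of_crossing (fun v => (hM v).1) hScr
      refine step ε hε0 hε1 (tight _ hfrac S hSodd hc1 hc2 ?_)
      rw [pair_recede, div_eq_one_iff_eq (sub_pos.2 hε1).ne']
      linarith
    · push Not at hS
      set ε := x v₀ (M v₀) with hε
      have hε0 : 0 < ε := (hM v₀).2
      have hfrac : IsFractional (recede x M ε) := by
        refine isFractional_recede hx hM h1 hv₀ fun S' hS' => ?_
        rcases le_or_gt (cross S') 1 with hc | hc
        · exact (mul_nonpos_of_nonneg_of_nonpos hε0.le (sub_nonpos.2 hc)).trans (hnn S' hS')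
        · exact hS S' hS' hc
      refine step ε hε0.le h1 (ihx _ ?_ hfrac rfl)
      refine Finset.card_lt_card (Finset.ssubset_iff_of_subset ?_ |>.2 ⟨(v₀, M v₀), ?_, ?_⟩)
      · intro p hp
        simp only [Finset.mem_filter, Finset.mem_univ, true_and] at hp ⊢
        unfold recede at hp
        rw [div_pos_iff_of_pos_right (sub_pos.2 h1)] at hp
        have : 0 ≤ ε * matchingArray M p.1 p.2 := by
          unfold matchingArray
          split_ifs <;> simp [hε0.le]
        linarith
      · simpa using hε0
      · simp [recede, matchingArray, ← hε]

end FractionalMatching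

namespace Multigraph

open FractionalMatching

lemma inc_eq_of_ends {G : Multigraph} {e : G.E} {p q : G.V} (h : G.ends e = s(p, q)) (u : G.V) :
    G.inc u e = (if p = u then 1 else 0) + if q = u then 1 else 0 := by
  unfold inc
  rw [h]
  by_cases hp : p = u <;> by_cases hq : q = u <;>
    simp [Sym2.diag, hp, hq, eq_comm (a := u)]

lemma mem_cutEdges_of_ends {G : Multigraph} {e : G.E} {p q : G.V} (h : G.ends e = s(p, q))
    (S : Set G.V) : e ∈ G.cutEdges S ↔ (p ∈ S ∧ q ∉ S) ∨ (q ∈ S ∧ p ∉ S) := by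
  simp only [cutEdges, Set.mem_ofPred_eq, h, Sym2.eq_iff]
  constructor
  · rintro ⟨u, v, ⟨rfl, rfl⟩ | ⟨rfl, rfl⟩, hu, hv⟩ <;> tauto
  · rintro (⟨h1, h2⟩ | ⟨h1, h2⟩)
    · exact ⟨p, q, by simp, h1, h2⟩
    · exact ⟨q, p, by simp, h1, h2⟩

lemma sum_degree_eq (G : Multigraph) (S : Finset G.V) :
    ∃ k, ∑ v ∈ S, G.degree v = (G.cutEdges S).ncard + 2 * k := by
  refine ⟨(Finset.univ.filter fun e => ∀ v ∈ G.ends e, v ∈ S).card, ?_⟩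
  rw [Set.ncard_eq_toFinset_card', Finset.card_filter, Set.toFinset_card, Fintype.card_subtype,
    Finset.card_filter, Finset.mul_sum, ← Finset.sum_add_distrib]
  simp only [degree]
  rw [Finset.sum_comm]
  refine Finset.sum_congr rfl fun e _ => ?_
  obtain ⟨⟨p, q⟩, h⟩ := Quot.exists_rep (G.ends e)
  replace h : G.ends e = s(p, q) := h.symm
  simp only [inc_eq_of_ends h, mem_cutEdges_of_ends h, h, Finset.sum_add_distrib,
    Finset.sum_ite_eq, Sym2.mem_iff, Finset.mem_coe]
  by_cases hp : p ∈ S <;> by_cases hq : q ∈ S <;> simp [hp, hq]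

/-- The array with entry one third of the number of edges joining the two (distinct) vertices. -/
def thirdArray (G : Multigraph) (u v : G.V) : ℝ :=
  if u = v then 0 else ((Finset.univ.filter fun e => G.ends e = s(u, v)).card : ℝ) / 3

lemma pair_thirdArray (G : Multigraph) (S : Finset G.V) :
    pair (cutIndicator S) G.thirdArray = ((G.cutEdges S).ncard : ℝ) / 3 := by
  have h1 : (G.cutEdges S).toFinset = (S ×ˢ Sᶜ).biUnion
      fun p => Finset.univ.filter fun e => G.ends e = s(p.1, p.2) := by
    ext e
    rw [Set.mem_toFinset]
    simp only [cutEdges, Set.mem_ofPred_eq, Finset.mem_biUnion,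
      Finset.mem_product, Finset.mem_compl, Finset.mem_filter, Finset.mem_univ, true_and,
      Prod.exists, Finset.mem_coe]
    exact ⟨fun ⟨u, v, h, hu, hv⟩ => ⟨u, v, ⟨hu, hv⟩, h⟩,
      fun ⟨u, v, ⟨hu, hv⟩, h⟩ => ⟨u, v, h, hu, hv⟩⟩
  rw [Set.ncard_eq_toFinset_card', h1, Finset.card_biUnion]
  · rw [Finset.sum_product, Nat.cast_sum, Finset.sum_div, pair,
      ← Finset.sum_subset (Finset.subset_univ S)]
    · refine Finset.sum_congr rfl fun u hu => ?_
      rw [Nat.cast_sum, Finset.sum_div, ← Finset.sum_subset (Finset.subset_univ Sᶜ)]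
      · refine Finset.sum_congr rfl fun v hv => ?_
        rw [Finset.mem_compl] at hv
        have : u ≠ v := fun h => hv (h ▸ hu)
        simp [cutIndicator, thirdArray, hu, hv, this]
      · intro v _ hv
        rw [Finset.mem_compl, not_not] at hv
        simp [cutIndicator, hv]
    · intro u _ hu
      simp [cutIndicator, hu]
  · rintro ⟨u, v⟩ huv ⟨u', v'⟩ huv' hne
    simp only [Finset.coe_product, Set.mem_prod, Finset.mem_coe, Finset.mem_compl] at huv huv'
    rw [Function.onFun, Finset.disjoint_left]
    intro e he he'
    simp only [Finset.mem_filter, Finset.mem_univ, true_and] at he he'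
    rw [he, Sym2.eq_iff] at he'
    rcases he' with ⟨rfl, rfl⟩ | ⟨rfl, rfl⟩
    · exact hne rfl
    · exact huv.2 huv'.1

lemma isFractional_thirdArray {G : Multigraph} (hcubic : G.IsCubic) (hbridge : G.EdgeConnected 2)
    (hV : Nontrivial G.V) : IsFractional G.thirdArray := by
  have key : ∀ S : Finset G.V, ∃ k, 3 * S.card = (G.cutEdges S).ncard + 2 * k := fun S => by
    obtain ⟨k, hk⟩ := G.sum_degree_eq S
    rw [Finset.sum_congr rfl fun v _ => hcubic v] at hk
    exact ⟨k, by simpa [mul_comm] using hk⟩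
  have hodd : ∀ S : Finset G.V, Odd S.card → 3 ≤ (G.cutEdges S).ncard := by
    rintro S ⟨j, hj⟩
    obtain ⟨k, hk⟩ := key S
    have hne : S.Nonempty := Finset.card_pos.1 (by omega)
    by_cases hS : (S : Set G.V) = Set.univ
    · have : G.cutEdges S = ∅ := by
        rw [hS]; ext e; simp [cutEdges]
      rw [this, Set.ncard_empty] at hk
      omega
    · have := hbridge S hne hS
      omega
  have hdiag : ∀ u, G.thirdArray u u = 0 := fun u => by simp [thirdArray]
  refine ⟨fun u v => ?_, hdiag, fun u v => ?_, fun u => ?_, fun S hS => ?_⟩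
  · simp only [thirdArray, eq_comm (a := u), Sym2.eq_swap (a := u)]
  · unfold thirdArray
    split_ifs <;> positivity
  · rw [← pair_cutIndicator_singleton hdiag, pair_thirdArray]
    obtain ⟨k, hk⟩ := key {u}
    have h3 := hodd {u} (by simp)
    rw [Finset.card_singleton] at hk
    have : (G.cutEdges ↑({u} : Finset G.V)).ncard = 3 := by omega
    rw [this]; norm_num
  · rw [pair_thirdArray, le_div_iff₀ (by norm_num)]
    exact_mod_cast (by simpa using hodd S hS)

lemma crossing_eq_one_of_isTightCut {G : Multigraph} {S : Finset G.V} (ht : G.IsTightCut S)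
    {M : G.V → G.V} (hM : IsMatching G.thirdArray M) :
    ∑ v, cutIndicator S v (M v) = 1 := by
  have hedge : ∀ v, ∃ e, G.ends e = s(v, M v) := by
    intro v
    have h := (hM v).2
    by_contra! hne
    simp [thirdArray, hne] at h
  have hne : ∀ v, v ≠ M v := by
    intro v h
    have h' := (hM v).2
    rw [← h] at h'
    simp [thirdArray] at h'
  have hinv : ∀ v, M (M v) = v := fun v => (hM v).1
  obtain ⟨c, hc⟩ : ∃ c : Sym2 G.V → G.E, ∀ v, G.ends (c s(v, M v)) = s(v, M v) := by
    choose e he using hedge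
    have : ∀ z : Sym2 G.V, ∃ e', (∃ e, G.ends e = z) → G.ends e' = z := by
      rintro ⟨p, q⟩
      by_cases h : ∃ e, G.ends e = s(p, q)
      · exact ⟨h.choose, fun _ => h.choose_spec⟩
      · exact ⟨e p, fun h' => absurd h' h⟩
    choose c hc using this
    exact ⟨c, fun v => hc _ ⟨e v, he v⟩⟩
  set N : Finset G.E := Finset.univ.image fun v => c s(v, M v) with hN
  have hmem : ∀ u v, v ∈ G.ends (c s(u, M u)) → s(u, M u) = s(v, M v) := by
    intro u v h
    rw [hc, Sym2.mem_iff] at h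
    rcases h with rfl | rfl
    · rfl
    · rw [hinv, Sym2.eq_swap]
  have hpm : G.IsPerfectMatching N := by
    refine ⟨fun e he => ?_, fun v => ⟨c s(v, M v), ⟨by simp [hN], by simp [hc]⟩, ?_⟩⟩
    · obtain ⟨v, -, rfl⟩ := Finset.mem_image.1 he
      rw [hc, Sym2.mk_isDiag_iff]
      exact hne v
    · rintro e ⟨he, hve⟩
      obtain ⟨u, -, rfl⟩ := Finset.mem_image.1 he
      simp only [hmem u v hve]
  have hcard := ht N hpm
  have hsum : ∑ v, cutIndicator S v (M v) =
      ((Finset.univ.filter fun v => v ∈ S ∧ M v ∉ S).card : ℝ) := by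
    simp [cutIndicator]
  rw [hsum, Nat.cast_eq_one, ← hcard]
  refine Finset.card_bij (fun v _ => c s(v, M v)) (fun v hv => ?_) (fun u hu v hv huv => ?_)
    fun e he => ?_
  · simp only [Finset.mem_filter, Finset.mem_univ, true_and] at hv ⊢
    exact ⟨by simp [hN], v, M v, hc v, hv.1, hv.2⟩
  · simp only [Finset.mem_filter, Finset.mem_univ, true_and] at hu hv
    have h := hc u
    rw [huv, hc v, Sym2.eq_iff] at h
    rcases h with ⟨h, -⟩ | ⟨h, -⟩
    · exact h.symm
    · exact absurd (h ▸ hv.1) hu.2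
  · obtain ⟨heN, hcut⟩ := Finset.mem_filter.1 he
    obtain ⟨v, -, rfl⟩ := Finset.mem_image.1 heN
    rw [mem_cutEdges_of_ends (hc v)] at hcut
    rcases hcut with h | h
    · exact ⟨v, by simpa using h, rfl⟩
    · refine ⟨M v, by simpa [hinv] using h, ?_⟩
      simp only [hinv, Sym2.eq_swap]

end Multigraph

open Multigraph
/-- In a cubic bridgeless graph, every tight edge-cut contains
exactly three edges. -/
theorem tightCut_card_three (G : Multigraph)
    (hcubic : G.IsCubic) (hbridgeless : G.Bridgeless)
    (A : Set G.V) (hA : A.Nonempty) (hA' : A ≠ Set.univ)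
    (htight : G.IsTightCut A) :
    (G.cutEdges A).ncard = 3 := by
  have hV : Nontrivial G.V := by
    obtain ⟨a, ha⟩ := hA
    obtain ⟨b, hb⟩ := (Set.ne_univ_iff_exists_notMem A).1 hA'
    exact ⟨a, b, fun h => hb (h ▸ ha)⟩
  have hdom := (isFractional_thirdArray hcubic hbridgeless.2 hV).dominated
  obtain ⟨S, rfl⟩ : ∃ S : Finset G.V, A = S := ⟨A.toFinset, by simp⟩
  have hpair := G.pair_thirdArray S
  obtain ⟨M, hM, hle⟩ := hdom (FractionalMatching.cutIndicator S)
  obtain ⟨M', hM', hle'⟩ := hdom fun u v => - FractionalMatching.cutIndicator S u v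
  have hneg : FractionalMatching.pair (fun u v => - FractionalMatching.cutIndicator S u v)
      G.thirdArray = - FractionalMatching.pair (FractionalMatching.cutIndicator S) G.thirdArray := by
    simp [FractionalMatching.pair]
  rw [crossing_eq_one_of_isTightCut htight hM, hpair] at hle
  rw [hneg, hpair, Finset.sum_neg_distrib, crossing_eq_one_of_isTightCut htight hM'] at hle'
  have : ((G.cutEdges S).ncard : ℝ) = 3 := by linarith
  exact_mod_cast this
end
end
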